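/- arXiv:2010.15641 — 2 statements merged into one kernel-verified Lean document; each statement's English description precedes it below -/
import Mathlib

section
/- There is a canonical bijection between the set of all absolute values on F extending |·|_K and the set of equivalence classes of K-algebra embeddings F → K̂^a, where two embeddings are equivalent if and only if they differ by composition with a K̂-algebra automorphism of K̂^a. -/
noncomputable section

/-- A sequence is Cauchy with respect to an absolute value. -/
def AbsCauchy {K : Type*} [Field K] (v : AbsoluteValue K ℝ) (s : ℕ → K) : Prop :=
  ∀ ε : ℝ, 0 < ε → ∃ N : ℕ, ∀ m ≥ N, ∀ n ≥ N, v (s m - s n) < ε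

/-- A sequence tends to a limit with respect to an absolute value. -/
def AbsTendsto {K : Type*} [Field K] (v : AbsoluteValue K ℝ) (s : ℕ → K) (a : K) : Prop :=
  ∀ ε : ℝ, 0 < ε → ∃ N : ℕ, ∀ n ≥ N, v (s n - a) < ε

/-- A field is complete with respect to an absolute value if every Cauchy sequence converges. -/
def AbsComplete {K : Type*} [Field K] (v : AbsoluteValue K ℝ) : Prop :=
  ∀ s : ℕ → K, AbsCauchy v s → ∃ a : K, AbsTendsto v s a

/-- The absolute value `vB` extends the absolute value `vA` along the embedding `f`. -/
def ExtendsAV {A B : Type*} [Field A] [Field B] (vA : AbsoluteValue A ℝ)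
    (vB : AbsoluteValue B ℝ) (f : A →+* B) : Prop :=
  ∀ x : A, vB (f x) = vA x

/-- `(B, vB, f)` is a completion of `(A, vA)`:  `f` is an isometric embedding with dense
image and `B` is complete. -/
structure IsCompletion {A B : Type*} [Field A] [Field B] (vA : AbsoluteValue A ℝ)
    (vB : AbsoluteValue B ℝ) (f : A →+* B) : Prop where
  extendsAV : ExtendsAV vA vB f
  complete : AbsComplete vB
  dense : ∀ y : B, ∀ ε : ℝ, 0 < ε → ∃ x : A, vB (y - f x) < ε

/-- Pullback of an absolute value along an embedding of fields. -/
def AbsoluteValue.comapRH {A B : Type*} [Field A] [Field B]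
    (v : AbsoluteValue B ℝ) (f : A →+* B) : AbsoluteValue A ℝ where
  toFun x := v (f x)
  map_mul' x y := by simp [map_mul]
  nonneg' x := v.nonneg _
  eq_zero' x := by
    rw [map_eq_zero, map_eq_zero]
  add_le' x y := by simpa using v.add_le (f x) (f y)

/-- If `a ^ n ≤ C * (n + 1) * b ^ n` for all `n`, then `a ≤ b`. -/
theorem le_of_forall_pow_le_const_mul {a b C : ℝ} (hb : 0 ≤ b)
    (h : ∀ n : ℕ, a ^ n ≤ C * (n + 1) * b ^ n) : a ≤ b := by
  rcases hb.eq_or_lt with rfl | hb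
  · simpa using h 1
  by_contra! hab
  have hr : 1 < a / b := (one_lt_div hb).2 hab
  have h1 := tendsto_pow_const_div_const_pow_of_one_lt 1 hr
  have h0 := tendsto_pow_const_div_const_pow_of_one_lt 0 hr
  have h2 := (h1.add h0).const_mul C
  have h3 : (1 : ℝ) ≤ C * (0 + 0) := by
    refine ge_of_tendsto' h2 fun n => ?_
    have hp : 0 < (a / b) ^ n := by positivity
    rw [pow_one, pow_zero, ← add_div, ← mul_div_assoc, one_le_div hp, div_pow,
      div_le_iff₀ (by positivity)]
    exact h n
  norm_num at h3

/-- The absolute value `x ↦ v x ^ t`, provided that it is subadditive. -/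
def AbsoluteValue.rpowOfAddLE {A : Type*} [Field A] (v : AbsoluteValue A ℝ) (t : ℝ) (ht : 0 < t)
    (hadd : ∀ x y, v (x + y) ^ t ≤ v x ^ t + v y ^ t) : AbsoluteValue A ℝ where
  toFun x := v x ^ t
  map_mul' x y := by rw [map_mul, Real.mul_rpow (v.nonneg _) (v.nonneg _)]
  nonneg' x := Real.rpow_nonneg (v.nonneg _) _
  eq_zero' x := by rw [Real.rpow_eq_zero (v.nonneg _) ht.ne', map_eq_zero]
  add_le' := hadd

theorem AbsoluteValue.rpow_add_le_of_natCast {A : Type*} [Field A] (v : AbsoluteValue A ℝ)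
    {t : ℝ} (ht : 0 < t) (hn : ∀ n : ℕ, v n ^ t = n) (x y : A) :
    v (x + y) ^ t ≤ v x ^ t + v y ^ t := by
  have key : v (x + y) ≤ (v x ^ t + v y ^ t) ^ t⁻¹ := by
    refine le_of_forall_pow_le_const_mul (C := 1)
      (Real.rpow_nonneg (add_nonneg (Real.rpow_nonneg (v.nonneg _) _)
        (Real.rpow_nonneg (v.nonneg _) _)) _) fun n => ?_
    have hx := Real.rpow_nonneg (v.nonneg x) t
    have hy := Real.rpow_nonneg (v.nonneg y) t
    have hterm : ∀ m ∈ Finset.range (n + 1),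
        v (x ^ m * y ^ (n - m) * (n.choose m : A)) ≤ ((v x ^ t + v y ^ t) ^ t⁻¹) ^ n := by
      intro m hm
      rw [← Real.rpow_le_rpow_iff (v.nonneg _) (by positivity) ht, map_mul, map_mul, map_pow,
        map_pow, Real.mul_rpow (by positivity) (by positivity),
        Real.mul_rpow (by positivity) (by positivity), hn, ← Real.rpow_natCast_mul (v.nonneg _),
        ← Real.rpow_natCast_mul (v.nonneg _), ← Real.rpow_natCast_mul (by positivity),
        mul_comm (m : ℝ), mul_comm ((n - m : ℕ) : ℝ), mul_comm (n : ℝ),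
        Real.rpow_mul_natCast (v.nonneg _), Real.rpow_mul_natCast (v.nonneg _),
        Real.rpow_mul_natCast (by positivity), Real.rpow_inv_rpow (by positivity) ht.ne', add_pow]
      exact Finset.single_le_sum
        (f := fun m => (v x ^ t) ^ m * (v y ^ t) ^ (n - m) * (n.choose m : ℝ))
        (fun i _ => by positivity) hm
    calc v (x + y) ^ n
      _ = v (∑ m ∈ Finset.range (n + 1), x ^ m * y ^ (n - m) * (n.choose m : A)) := by
          rw [← map_pow, add_pow]
      _ ≤ ∑ m ∈ Finset.range (n + 1), v (x ^ m * y ^ (n - m) * (n.choose m : A)) :=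
          v.sum_le _ _
      _ ≤ ∑ m ∈ Finset.range (n + 1), ((v x ^ t + v y ^ t) ^ t⁻¹) ^ n := Finset.sum_le_sum hterm
      _ = 1 * (n + 1) * ((v x ^ t + v y ^ t) ^ t⁻¹) ^ n := by simp
  have hx := Real.rpow_nonneg (v.nonneg x) t
  have hy := Real.rpow_nonneg (v.nonneg y) t
  calc v (x + y) ^ t ≤ ((v x ^ t + v y ^ t) ^ t⁻¹) ^ t :=
        Real.rpow_le_rpow (v.nonneg _) key ht.le
    _ = _ := Real.rpow_inv_rpow (by positivity) ht.ne'

/-- Isometric ring homomorphisms into a complete field extend along dense isometric embeddings. -/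
theorem exists_isometry_extension {A B C : Type*} [NormedField A] [NormedField B] [NormedField C]
    [CompleteSpace C] (i : A →+* B) (hi : Isometry i) (hd : DenseRange i) (f : A →+* C)
    (hf : Isometry f) : ∃ g : B →+* C, (∀ b, ‖g b‖ = ‖b‖) ∧ ∀ a, g (i a) = f a := by
  have hi' := hi.isUniformInducing
  let g := IsDenseInducing.extendRingHom hi' hd hf.uniformContinuous
  have hg : Continuous g :=
    (uniformContinuous_uniformly_extend hi' hd hf.uniformContinuous).continuous
  have hgi : ∀ a, g (i a) = f a :=
    fun a => IsDenseInducing.extend_eq (hi'.isDenseInducing hd) hf.continuous a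
  refine ⟨g, fun b => ?_, hgi⟩
  refine hd.induction_on b (isClosed_eq (by fun_prop) (by fun_prop)) fun a => ?_
  rw [hgi, hf.norm_map_of_map_zero (map_zero f), hi.norm_map_of_map_zero (map_zero i)]

theorem AbsoluteValue.exists_le_mul_of_finiteDimensional {k E : Type*} [NontriviallyNormedField k]
    [CompleteSpace k] [Field E] [Algebra k E] [FiniteDimensional k E] (w₁ w₂ : AbsoluteValue E ℝ)
    (h₁ : ∀ x, w₁ (algebraMap k E x) = ‖x‖) (h₂ : ∀ x, w₂ (algebraMap k E x) = ‖x‖) :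
    ∃ C, ∀ x, w₁ x ≤ C * w₂ x := by
  let a₁ : NormedAlgebra k (WithAbs w₁) :=
    { (inferInstance : Algebra k (WithAbs w₁)) with
      norm_smul_le r x := by
        rw [Algebra.smul_def, norm_mul]
        exact (congrArg (· * ‖x‖) (h₁ r)).le }
  let a₂ : NormedAlgebra k (WithAbs w₂) :=
    { (inferInstance : Algebra k (WithAbs w₂)) with
      norm_smul_le r x := by
        rw [Algebra.smul_def, norm_mul]
        exact (congrArg (· * ‖x‖) (h₂ r)).le }
  let e : WithAbs w₂ →ₗ[k] WithAbs w₁ :=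
    ((WithAbs.algEquiv k w₂).trans (WithAbs.algEquiv k w₁).symm).toLinearMap
  have : FiniteDimensional k (WithAbs w₂) := inferInstance
  let e' : WithAbs w₂ →L[k] WithAbs w₁ := LinearMap.toContinuousLinearMap e
  exact ⟨‖e'‖, fun x => e'.le_opNorm (WithAbs.toAbs w₂ x)⟩

theorem AbsoluteValue.apply_le_of_finiteDimensional {k E : Type*} [NontriviallyNormedField k]
    [CompleteSpace k] [Field E] [Algebra k E] [FiniteDimensional k E] (w₁ w₂ : AbsoluteValue E ℝ)
    (h₁ : ∀ x, w₁ (algebraMap k E x) = ‖x‖) (h₂ : ∀ x, w₂ (algebraMap k E x) = ‖x‖) (x : E) :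
    w₁ x ≤ w₂ x := by
  obtain ⟨C, hC⟩ := exists_le_mul_of_finiteDimensional w₁ w₂ h₁ h₂
  have hC0 : 0 ≤ C := by
    have := hC 1
    rw [map_one, map_one, mul_one] at this
    exact zero_le_one.trans this
  refine le_of_forall_pow_le_const_mul (C := C) (w₂.nonneg x) fun n => ?_
  rw [← map_pow, ← map_pow]
  refine (hC _).trans (mul_le_mul_of_nonneg_right ?_ (w₂.nonneg _))
  nlinarith [(n.cast_nonneg : (0 : ℝ) ≤ n)]

theorem AbsoluteValue.eq_of_isAlgebraic {k E : Type*} [NontriviallyNormedField k]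
    [CompleteSpace k] [Field E] [Algebra k E] [Algebra.IsAlgebraic k E] (w₁ w₂ : AbsoluteValue E ℝ)
    (h₁ : ∀ x, w₁ (algebraMap k E x) = ‖x‖) (h₂ : ∀ x, w₂ (algebraMap k E x) = ‖x‖) :
    w₁ = w₂ := by
  ext x
  let S := IntermediateField.adjoin k {x}
  have : FiniteDimensional k S :=
    IntermediateField.adjoin.finiteDimensional (Algebra.IsIntegral.isIntegral x)
  let y : S := ⟨x, IntermediateField.mem_adjoin_simple_self k x⟩
  exact le_antisymm
    (apply_le_of_finiteDimensional (w₁.comapRH (algebraMap S E)) (w₂.comapRH (algebraMap S E))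
      h₁ h₂ y)
    (apply_le_of_finiteDimensional (w₂.comapRH (algebraMap S E)) (w₁.comapRH (algebraMap S E))
      h₂ h₁ y)

/-- An absolute value which is trivial on a subfield is trivial on every algebraic extension. -/
theorem AbsoluteValue.eq_one_of_isAlgebraic {k E : Type*} [Field k] [Field E] [Algebra k E]
    [Algebra.IsAlgebraic k E] (w : AbsoluteValue E ℝ)
    (h : ∀ x : k, x ≠ 0 → w (algebraMap k E x) = 1) {x : E} (hx : x ≠ 0) : w x = 1 := by
  have hle : ∀ c : k, w (algebraMap k E c) ≤ 1 := fun c => by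
    by_cases hc : c = 0
    · simp [hc]
    · exact (h c hc).le
  have bound : ∀ x : E, w x ≤ 1 := fun x => by
    let S := IntermediateField.adjoin k {x}
    have : FiniteDimensional k S :=
      IntermediateField.adjoin.finiteDimensional (Algebra.IsIntegral.isIntegral x)
    let b := Module.finBasis k S
    have hb : ∀ y : S, w y ≤ ∑ i, w (b i) := fun y => by
      conv_lhs => rw [← b.sum_repr y]
      rw [AddSubmonoidClass.coe_finsetSum]
      refine (w.sum_le _ _).trans (Finset.sum_le_sum fun i _ => ?_)
      rw [Algebra.smul_def, MulMemClass.coe_mul, map_mul]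
      exact mul_le_of_le_one_left (w.nonneg _) (hle _)
    refine le_of_forall_pow_le_const_mul (C := ∑ i, w (b i)) zero_le_one fun n => ?_
    have h1 : 0 ≤ ∑ i, w (b i) := Finset.sum_nonneg fun i _ => w.nonneg _
    rw [← map_pow, one_pow, mul_one]
    have h2 := hb ((⟨x, IntermediateField.mem_adjoin_simple_self k x⟩ : S) ^ n)
    refine h2.trans ?_
    nlinarith [(n.cast_nonneg : (0 : ℝ) ≤ n)]
  refine le_antisymm (bound x) ?_
  have h3 := bound x⁻¹
  rwa [map_inv₀, inv_le_one₀ (w.pos hx)] at h3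

theorem AbsComplete.completeSpace {A : Type*} [NormedField A] {v : AbsoluteValue A ℝ}
    (h : AbsComplete v) (hv : ∀ x, v x = ‖x‖) : CompleteSpace A := by
  refine Metric.complete_of_cauchySeq_tendsto fun s hs => ?_
  rw [Metric.cauchySeq_iff] at hs
  obtain ⟨a, ha⟩ := h s fun ε hε => by
    obtain ⟨N, hN⟩ := hs ε hε
    exact ⟨N, fun m hm n hn => by rw [hv, ← dist_eq_norm]; exact hN m hm n hn⟩
  refine ⟨a, Metric.tendsto_atTop.2 fun ε hε => ?_⟩
  obtain ⟨N, hN⟩ := ha ε hε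
  exact ⟨N, fun n hn => by rw [dist_eq_norm, ← hv]; exact hN n hn⟩

theorem AbsComplete.rpowOfAddLE {A : Type*} [Field A] {v : AbsoluteValue A ℝ} (h : AbsComplete v)
    {t : ℝ} (ht : 0 < t) (hadd : ∀ x y, v (x + y) ^ t ≤ v x ^ t + v y ^ t) :
    AbsComplete (v.rpowOfAddLE t ht hadd) := by
  have hlt : ∀ x ε, 0 < ε → (v.rpowOfAddLE t ht hadd x < ε ↔ v x < ε ^ t⁻¹) := fun x ε hε =>
    (Real.lt_rpow_inv_iff_of_pos (v.nonneg x) hε.le ht).symm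
  intro s hs
  obtain ⟨a, ha⟩ := h s fun ε hε => by
    obtain ⟨N, hN⟩ := hs (ε ^ t) (Real.rpow_pos_of_pos hε t)
    refine ⟨N, fun m hm n hn => ?_⟩
    have := (hlt _ _ (Real.rpow_pos_of_pos hε t)).1 (hN m hm n hn)
    rwa [Real.rpow_rpow_inv hε.le ht.ne'] at this
  refine ⟨a, fun ε hε => ?_⟩
  obtain ⟨N, hN⟩ := ha (ε ^ t⁻¹) (Real.rpow_pos_of_pos hε _)
  exact ⟨N, fun n hn => (hlt _ _ hε).2 (hN n hn)⟩

/-- A complete field whose norm restricts to the usual absolute value on `ℕ` embeds isometrically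
into `ℂ`. -/
theorem exists_isometric_embedding_complex {k : Type*} [NormedField k] [CompleteSpace k]
    (hn : ∀ n : ℕ, ‖(n : k)‖ = n) : ∃ j : k →+* ℂ, ∀ x, ‖j x‖ = ‖x‖ := by
  have hc : CharZero k := charZero_of_inj_zero fun n h => by
    simpa [h, eq_comm] using hn n
  have hz : ∀ n : ℤ, ‖(n : k)‖ = |(n : ℝ)| := fun n => by
    rcases n.eq_nat_or_neg with ⟨m, rfl | rfl⟩ <;> simp [hn]
  have hq : ∀ q : ℚ, ‖(q : k)‖ = ‖q‖ := fun q => by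
    rw [Rat.cast_def, norm_div, hz, hn, ← Rat.norm_cast_real, Rat.cast_def, Real.norm_eq_abs,
      abs_div, Nat.abs_cast]
  obtain ⟨g, hg, -⟩ := exists_isometry_extension (algebraMap ℚ ℝ)
    (AddMonoidHomClass.isometry_of_norm _ fun q => by simp) Rat.denseRange_cast (algebraMap ℚ k)
    (AddMonoidHomClass.isometry_of_norm _ fun q => by simpa using hq q)
  let _ : Algebra ℝ k := g.toAlgebra
  let _ : NormedAlgebra ℝ k :=
    { norm_smul_le r x := by rw [Algebra.smul_def, norm_mul]; exact (congrArg (· * ‖x‖) (hg r)).le }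
  have hfin : FiniteDimensional ℝ k ∧ Nonempty (k →ₐ[ℝ] ℂ) := by
    rcases NormedAlgebra.Real.nonempty_algEquiv_or k with ⟨⟨e⟩⟩ | ⟨⟨e⟩⟩
    · exact ⟨Module.Finite.equiv e.symm.toLinearEquiv, ⟨(Algebra.ofId ℝ ℂ).comp e.toAlgHom⟩⟩
    · exact ⟨Module.Finite.equiv e.symm.toLinearEquiv, ⟨e.toAlgHom⟩⟩
  obtain ⟨_, ⟨j⟩⟩ := hfin
  refine ⟨j, fun x => ?_⟩
  exact DFunLike.congr_fun (AbsoluteValue.eq_of_isAlgebraic (k := ℝ)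
    ((NormedField.toAbsoluteValue ℂ).comapRH j.toRingHom) (NormedField.toAbsoluteValue k)
    (fun r => (congrArg norm (j.commutes r)).trans (by simp)) hg) x

/-- A field complete with respect to an archimedean absolute value embeds into `ℂ`, the absolute
value being induced by a power of the usual one. -/
theorem AbsComplete.exists_embedding_complex {k : Type*} [Field k] {v : AbsoluteValue k ℝ}
    (hv : AbsComplete v) (hu : ¬ ∀ n : ℕ, v n ≤ 1) :
    ∃ (s : ℝ) (j : k →+* ℂ), 0 < s ∧ s ≤ 1 ∧ ∀ x, v x = ‖j x‖ ^ s := by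
  have hc : CharZero k := charZero_of_inj_zero fun m hm => by
    by_contra hm0
    refine hu fun n => le_of_forall_pow_le_const_mul (C := m) zero_le_one fun i => ?_
    have h1 : (n : k) ^ i = ((n ^ i % m : ℕ) : k) := by
      conv_lhs => rw [← Nat.cast_pow, ← Nat.div_add_mod (n ^ i) m]
      simp [hm]
    rw [← map_pow, h1, one_pow, mul_one]
    refine (v.apply_nat_le_self _).trans ?_
    have h2 : ((n ^ i % m : ℕ) : ℝ) ≤ m := by
      exact_mod_cast (Nat.mod_lt _ (Nat.pos_of_ne_zero hm0)).le
    nlinarith [(i.cast_nonneg : (0 : ℝ) ≤ i), (m.cast_nonneg : (0 : ℝ) ≤ m)]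
  have hu' : ¬ ∀ n : ℕ, v.comapRH (algebraMap ℚ k) n ≤ 1 := fun h => hu fun n => by
    simpa [AbsoluteValue.comapRH] using! h n
  obtain ⟨t, ht, hvt⟩ := AbsoluteValue.isEquiv_iff_exists_rpow_eq.1
    (Rat.AbsoluteValue.equiv_real_of_unbounded hu')
  have hn : ∀ n : ℕ, v n ^ t = n := fun n => by
    have := congrFun hvt n
    simp only [Rat.AbsoluteValue.real_eq_abs] at this
    simpa [AbsoluteValue.comapRH] using! this
  have hadd := v.rpow_add_le_of_natCast ht hn
  let w := v.rpowOfAddLE t ht hadd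
  let _ : NormedField k := w.toNormedField
  have : CompleteSpace k := (hv.rpowOfAddLE ht hadd).completeSpace fun x => rfl
  obtain ⟨j, hj⟩ := exists_isometric_embedding_complex (k := k) hn
  have ht1 : 1 ≤ t := by
    by_contra! h
    have h2 := hn 2
    have h3 : v (2 : ℕ) ^ t ≤ ((2 : ℕ) : ℝ) ^ t :=
      Real.rpow_le_rpow (v.nonneg _) (v.apply_nat_le_self 2) ht.le
    have h4 : ((2 : ℕ) : ℝ) ^ t < ((2 : ℕ) : ℝ) ^ (1 : ℝ) :=
      Real.rpow_lt_rpow_of_exponent_lt (by norm_num) h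
    rw [Real.rpow_one] at h4
    linarith
  refine ⟨t⁻¹, j, inv_pos.2 ht, inv_le_one_of_one_le₀ ht1, fun x => ?_⟩
  rw [hj]
  exact (Real.rpow_rpow_inv (v.nonneg x) ht.ne').symm

theorem AbsComplete.exists_extendsAV {k E : Type*} [Field k] [Field E] [Algebra k E]
    [Algebra.IsAlgebraic k E] {v : AbsoluteValue k ℝ} (hv : AbsComplete v) :
    ∃ u : AbsoluteValue E ℝ, ExtendsAV v u (algebraMap k E) := by
  classical
  by_cases hu : ∀ n : ℕ, v n ≤ 1
  · by_cases hnt : v.IsNontrivial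
    · let _ : NontriviallyNormedField k :=
        { v.toNormedField with non_trivial := hnt.exists_abv_gt_one }
      have : CompleteSpace k := hv.completeSpace fun x => rfl
      have : IsUltrametricDist k :=
        IsUltrametricDist.isUltrametricDist_of_forall_norm_natCast_le_one hu
      let n : NormedField E := spectralNorm.normedField k E
      exact ⟨@NormedField.toAbsoluteValue E n, fun x => spectralNorm_extends x⟩
    · refine ⟨AbsoluteValue.trivial, fun x => ?_⟩
      rw [AbsoluteValue.not_isNontrivial_iff] at hnt
      by_cases hx : x = 0
      · simp [hx]
      · rw [hnt x hx, AbsoluteValue.trivial_apply (by simpa using hx)]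
  · obtain ⟨s, j, hs, hs1, hj⟩ := hv.exists_embedding_complex hu
    let _ : Algebra k ℂ := j.toAlgebra
    let J : E →ₐ[k] ℂ := IsAlgClosed.lift
    refine ⟨((NormedField.toAbsoluteValue ℂ).comapRH J.toRingHom).rpowOfAddLE s hs
      fun x y => ?_, fun x => ?_⟩
    · have h0 := AbsoluteValue.nonneg ((NormedField.toAbsoluteValue ℂ).comapRH J.toRingHom)
      exact (Real.rpow_le_rpow (h0 _) (AbsoluteValue.add_le _ x y) hs.le).trans
        (Real.rpow_add_le_add_rpow (h0 x) (h0 y) hs.le hs1)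
    · rw [hj x]
      exact congrArg (fun z : ℂ => ‖z‖ ^ s) (J.commutes x)

theorem AbsComplete.extendsAV_unique {k E : Type*} [Field k] [Field E] [Algebra k E]
    [Algebra.IsAlgebraic k E] {v : AbsoluteValue k ℝ} (hv : AbsComplete v)
    {w₁ w₂ : AbsoluteValue E ℝ} (h₁ : ExtendsAV v w₁ (algebraMap k E))
    (h₂ : ExtendsAV v w₂ (algebraMap k E)) : w₁ = w₂ := by
  by_cases hnt : v.IsNontrivial
  · let _ : NontriviallyNormedField k :=
      { v.toNormedField with non_trivial := hnt.exists_abv_gt_one }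
    have : CompleteSpace k := hv.completeSpace fun x => rfl
    exact AbsoluteValue.eq_of_isAlgebraic w₁ w₂ h₁ h₂
  · rw [AbsoluteValue.not_isNontrivial_iff] at hnt
    ext x
    by_cases hx : x = 0
    · simp [hx]
    · rw [w₁.eq_one_of_isAlgebraic (fun y hy => (h₁ y).trans (hnt y hy)) hx,
        w₂.eq_one_of_isAlgebraic (fun y hy => (h₂ y).trans (hnt y hy)) hx]

theorem IsAlgClosed.exists_algHom_comp_eq {k R S M : Type*} [Field k] [CommRing R] [Field S]
    [Field M] [Algebra k R] [Algebra k S] [Algebra k M] [Algebra.IsAlgebraic k S] [IsAlgClosed M]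
    (i : R →ₐ[k] S) (g : R →ₐ[k] M) (h : ∀ r, i r = 0 ↔ g r = 0) :
    ∃ τ : S →ₐ[k] M, ∀ r, τ (i r) = g r := by
  let g' : i.range →ₐ[k] M :=
    (Ideal.Quotient.liftₐ (RingHom.ker i) g fun r hr => (h r).1 hr).comp
      (Ideal.quotientKerEquivRange i).symm.toAlgHom
  have hg' : ∀ r, g' (i.rangeRestrict r) = g r := fun r => by
    have : (Ideal.quotientKerEquivRange i).symm (i.rangeRestrict r) = Ideal.Quotient.mk _ r := by
      rw [AlgEquiv.symm_apply_eq]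
      rfl
    simp only [g', AlgHom.comp_apply]
    exact (congrArg (Ideal.Quotient.liftₐ (RingHom.ker i) g fun r hr => (h r).1 hr) this).trans rfl
  have hinj : Function.Injective g' := by
    rw [injective_iff_map_eq_zero]
    rintro ⟨_, r, rfl⟩ hr
    exact Subtype.ext ((h r).2 ((hg' r).symm.trans hr))
  let _ : Algebra i.range M := g'.toRingHom.toAlgebra
  have : FaithfulSMul i.range M := (faithfulSMul_iff_algebraMap_injective _ _).2 hinj
  have : IsScalarTower k i.range M := .of_algebraMap_eq fun x => (g'.commutes x).symm
  have : Algebra.IsAlgebraic i.range S := Algebra.IsAlgebraic.extendScalars (R := k)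
    (algebraMap k i.range).injective
  let τ : S →ₐ[i.range] M := IsAlgClosed.lift
  exact ⟨τ.restrictScalars k, fun r => (τ.commutes (i.rangeRestrict r)).trans (hg' r)⟩

/-- A `K`-embedding of an algebraic extension `F` of `K` into an extension `L` of `k` gives rise to
an embedding into an algebraic closure of `k` with the same absolute value. -/
theorem AbsComplete.exists_algHom_of_ringHom {K F k A L : Type*} [Field K] [Field F] [Field k]
    [Field A] [Field L] [Algebra K F] [Algebra.IsAlgebraic K F] [Algebra K k] [Algebra k A]
    [IsAlgClosed A] [Algebra K A] [IsScalarTower K k A]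
    [Algebra.IsAlgebraic k A] {v : AbsoluteValue k ℝ} (hv : AbsComplete v) {u : AbsoluteValue A ℝ}
    (hu : ExtendsAV v u (algebraMap k A)) (wL : AbsoluteValue L ℝ) (g : k →+* L)
    (hg : ExtendsAV v wL g) (c : F →+* L)
    (hgc : ∀ x : K, g (algebraMap K k x) = c (algebraMap K F x)) :
    ∃ φ : F →ₐ[K] A, ∀ x, u (φ x) = wL (c x) := by
  let _ : Algebra k L := g.toAlgebra
  let _ : Algebra K L := (g.comp (algebraMap K k)).toAlgebra
  have : IsScalarTower K k L := .of_algebraMap_eq fun _ => rfl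
  let c' : F →ₐ[K] L := { c with commutes' := fun x => (hgc x).symm }
  let E := algebraicClosure k L
  let ρ : E →ₐ[k] A := IsAlgClosed.lift
  have hmem : ∀ x, c x ∈ E := fun x => by
    rw [mem_algebraicClosure_iff]
    exact (((Algebra.IsAlgebraic.isAlgebraic (R := K) x).algHom c').tower_top k :)
  let cE : F →ₐ[K] E := (c'.codRestrict (E.toSubalgebra.restrictScalars K) hmem)
  have huE : u.comapRH ρ.toRingHom = wL.comapRH (algebraMap E L) :=
    hv.extendsAV_unique (fun x => (congrArg u (ρ.commutes x)).trans (hu x)) hg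
  exact ⟨(ρ.restrictScalars K).comp cE, fun x => DFunLike.congr_fun huE (cE x)⟩

theorem IsCompletion.exists_algHom {K F k A : Type*} [Field K] [Field F] [Field k]
    [Field A] [Algebra K F] [Algebra.IsAlgebraic K F] [Algebra K k] [Algebra k A]
    [IsAlgClosed A] [Algebra K A] [IsScalarTower K k A] [Algebra.IsAlgebraic k A]
    {vK : AbsoluteValue K ℝ} {v : AbsoluteValue k ℝ} (hv : IsCompletion vK v (algebraMap K k))
    {u : AbsoluteValue A ℝ} (hu : ExtendsAV v u (algebraMap k A)) {w : AbsoluteValue F ℝ}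
    (hw : ExtendsAV vK w (algebraMap K F)) : ∃ φ : F →ₐ[K] A, ∀ x, u (φ x) = w x := by
  let c : F →+* w.Completion :=
    (UniformSpace.Completion.coeRingHom (α := WithAbs w)).comp (WithAbs.equiv w).symm.toRingHom
  have hc : ∀ x, ‖c x‖ = w x := fun x => UniformSpace.Completion.norm_coe (WithAbs.toAbs w x)
  obtain ⟨g, hg, hgc⟩ : ∃ g : k →+* w.Completion, (∀ x, ‖g x‖ = v x) ∧
      ∀ x, g (algebraMap K k x) = c (algebraMap K F x) := by
    let _ : NormedField K := vK.toNormedField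
    let _ : NormedField k := v.toNormedField
    refine exists_isometry_extension (algebraMap K k)
      (AddMonoidHomClass.isometry_of_norm _ hv.extendsAV) ?_ (c.comp (algebraMap K F))
      (AddMonoidHomClass.isometry_of_norm _ fun x => (hc _).trans (hw x))
    refine Metric.denseRange_iff.2 fun y ε hε => ?_
    obtain ⟨x, hx⟩ := hv.dense y ε hε
    exact ⟨x, by rw [dist_eq_norm]; exact hx⟩
  obtain ⟨φ, hφ⟩ := hv.complete.exists_algHom_of_ringHom hu
    (NormedField.toAbsoluteValue w.Completion) g hg c hgc
  exact ⟨φ, fun x => (hφ x).trans (hc x)⟩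

open scoped TensorProduct in
theorem IsCompletion.apply_productLeftAlgHom_le {K F k A : Type*} [Field K] [Field F] [Field k]
    [Field A] [Algebra K F] [Algebra K k] [Algebra k A] [Algebra K A] [IsScalarTower K k A]
    {vK : AbsoluteValue K ℝ} {v : AbsoluteValue k ℝ} (hv : IsCompletion vK v (algebraMap K k))
    {u : AbsoluteValue A ℝ} (hu : ExtendsAV v u (algebraMap k A)) {φ ψ : F →ₐ[K] A}
    (h : ∀ x, u (φ x) = u (ψ x)) (z : k ⊗[K] F) :
    u (Algebra.TensorProduct.productLeftAlgHom (Algebra.ofId k A) ψ z) ≤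
      u (Algebra.TensorProduct.productLeftAlgHom (Algebra.ofId k A) φ z) := by
  set P := Algebra.TensorProduct.productLeftAlgHom (Algebra.ofId k A) φ
  set Q := Algebra.TensorProduct.productLeftAlgHom (Algebra.ofId k A) ψ
  have approx : ∀ ε : ℝ, 0 < ε → ∃ x : F, u (P z - φ x) < ε ∧ u (Q z - ψ x) < ε := by
    induction z with
    | zero => exact fun ε hε => ⟨0, by simpa using hε, by simpa using hε⟩
    | tmul a f =>
      intro ε hε
      have hf : 0 ≤ u (φ f) := u.nonneg _
      obtain ⟨b, hb⟩ := hv.dense a (ε / (u (φ f) + 1)) (by positivity)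
      have key : ∀ θ : F →ₐ[K] A, u (θ f) = u (φ f) →
          u (algebraMap k A a * θ f - θ (b • f)) < ε := fun θ hθ => by
        rw [map_smul, Algebra.smul_def, IsScalarTower.algebraMap_apply K k A, ← sub_mul,
          ← map_sub, map_mul, hu, hθ]
        rw [lt_div_iff₀ (by positivity)] at hb
        nlinarith [v.nonneg (a - algebraMap K k b)]
      exact ⟨b • f, by simpa [P] using! key φ rfl, by simpa [Q] using! key ψ (h f).symm⟩
    | add z₁ z₂ h₁ h₂ =>
      intro ε hε
      obtain ⟨x₁, hp₁, hq₁⟩ := h₁ (ε / 2) (half_pos hε)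
      obtain ⟨x₂, hp₂, hq₂⟩ := h₂ (ε / 2) (half_pos hε)
      refine ⟨x₁ + x₂, ?_, ?_⟩
      · rw [map_add, map_add, add_sub_add_comm]
        linarith [u.add_le (P z₁ - φ x₁) (P z₂ - φ x₂)]
      · rw [map_add, map_add, add_sub_add_comm]
        linarith [u.add_le (Q z₁ - ψ x₁) (Q z₂ - ψ x₂)]
  refine le_of_forall_pos_le_add fun ε hε => ?_
  obtain ⟨x, hp, hq⟩ := approx (ε / 2) (half_pos hε)
  have h₁ := u.sub_le (Q z) (ψ x) 0
  have h₂ := u.sub_le (φ x) (P z) 0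
  rw [sub_zero, sub_zero] at h₁ h₂
  rw [u.map_sub (φ x)] at h₂
  linarith [h x]

theorem IsCompletion.exists_algEquiv {K F k A : Type*} [Field K] [Field F] [Field k]
    [Field A] [Algebra K F] [Algebra K k] [Algebra k A] [Algebra K A] [IsScalarTower K k A]
    [IsAlgClosed A] [Algebra.IsAlgebraic k A]
    {vK : AbsoluteValue K ℝ} {v : AbsoluteValue k ℝ} (hv : IsCompletion vK v (algebraMap K k))
    {u : AbsoluteValue A ℝ} (hu : ExtendsAV v u (algebraMap k A)) {φ ψ : F →ₐ[K] A}
    (h : ∀ x, u (φ x) = u (ψ x)) : ∃ τ : A ≃ₐ[k] A, ∀ x, ψ x = τ (φ x) := by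
  obtain ⟨τ, hτ⟩ := IsAlgClosed.exists_algHom_comp_eq
    (Algebra.TensorProduct.productLeftAlgHom (Algebra.ofId k A) φ)
    (Algebra.TensorProduct.productLeftAlgHom (Algebra.ofId k A) ψ) fun z => by
      rw [← u.eq_zero, ← u.eq_zero, le_antisymm (hv.apply_productLeftAlgHom_le hu h z)
        (hv.apply_productLeftAlgHom_le hu (fun x => (h x).symm) z)]
  refine ⟨AlgEquiv.ofBijective τ (Algebra.IsAlgebraic.algHom_bijective τ), fun x => ?_⟩
  simpa using (hτ (1 ⊗ₜ x)).symm

/-- **Corollary (extensions of an absolute value to a finite extension).**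
Let `F/K` be a finite extension of fields, `vK` an absolute value on `K`, `K̂` the completion
of `K`, and `K̂ᵃ` an algebraic closure of `K̂` (with the unique absolute value extending that
of `K̂`).  Then there is a bijection between the set of absolute values on `F` extending `vK`
and the set of equivalence classes of `K`-algebra embeddings `F → K̂ᵃ`, where two embeddings
are equivalent iff they differ by composition with a `K̂`-algebra automorphism of `K̂ᵃ`. -/
theorem extensions_of_absolute_value
    {K F : Type*} [Field K] [Field F] [Algebra K F] [FiniteDimensional K F]
    (vK : AbsoluteValue K ℝ)
    {Kh : Type*} [Field Kh] [Algebra K Kh]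
    (vKh : AbsoluteValue Kh ℝ) (hKh : IsCompletion vK vKh (algebraMap K Kh))
    {Ka : Type*} [Field Ka] [Algebra Kh Ka] [IsAlgClosure Kh Ka]
    [Algebra K Ka] [IsScalarTower K Kh Ka] :
    Nonempty (
      {w : AbsoluteValue F ℝ // ExtendsAV vK w (algebraMap K F)}
      ≃ Quot (fun φ ψ : F →ₐ[K] Ka => ∃ τ : Ka ≃ₐ[Kh] Ka, ∀ x : F, ψ x = τ (φ x))) := by
  have hcl : IsAlgClosed Ka := IsAlgClosure.isAlgClosed Kh
  have halg : Algebra.IsAlgebraic Kh Ka := IsAlgClosure.isAlgebraic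
  obtain ⟨u, hu⟩ := hKh.complete.exists_extendsAV (E := Ka)
  let res : Quot (fun φ ψ : F →ₐ[K] Ka => ∃ τ : Ka ≃ₐ[Kh] Ka, ∀ x : F, ψ x = τ (φ x)) →
      {w : AbsoluteValue F ℝ // ExtendsAV vK w (algebraMap K F)} :=
    Quot.lift (fun φ => ⟨u.comapRH φ.toRingHom, fun x => by
      have hx : u (φ (algebraMap K F x)) = vK x := by
        rw [φ.commutes, IsScalarTower.algebraMap_apply K Kh Ka, hu, hKh.extendsAV]
      exact hx⟩) fun φ ψ ⟨τ, hτ⟩ => by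
        have huτ : u.comapRH τ.toRingEquiv.toRingHom = u :=
          hKh.complete.extendsAV_unique (fun x => (congrArg u (τ.commutes x)).trans (hu x)) hu
        ext x
        exact ((congrArg u (hτ x)).trans (DFunLike.congr_fun huτ (φ x))).symm
  refine ⟨(Equiv.ofBijective res ⟨?_, ?_⟩).symm⟩
  · rintro ⟨φ⟩ ⟨ψ⟩ h
    exact Quot.sound (hKh.exists_algEquiv hu fun x =>
      DFunLike.congr_fun (congrArg Subtype.val h) x)
  · rintro ⟨w, hw⟩
    obtain ⟨φ, hφ⟩ := hKh.exists_algHom hu hw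
    exact ⟨Quot.mk _ φ, Subtype.ext (AbsoluteValue.ext hφ)⟩
end
end

section
/- The identity ∑_{i=1}^n ∑_{Q ∈ 𝒫_i} e(Q/S) = e(P/S) · e(R/S) holds. -/
open scoped TensorProduct

noncomputable section

/-- `K` is the function field of a curve over `k`: a finitely generated field extension of
`k` of transcendence degree `1` (finite over `k(x)` for some transcendental `x`), whose
field of constants is `k` itself. -/
def IsFunctionFieldOver (k K : Type*) [Field k] [Field K] [Algebra k K] : Prop :=
  (∃ x : K, Transcendental k x ∧
    FiniteDimensional ↥(IntermediateField.adjoin k {x}) K) ∧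
  (∀ x : K, IsAlgebraic k x → x ∈ (algebraMap k K).range)

/-- A place of a function field `K/k`: a normalized (i.e. surjective onto `ℤₘ₀`) discrete
valuation which is trivial on the constant field `k`. -/
def IsPlace {k K : Type*} [Field k] [Field K] [Algebra k K]
    (w : Valuation K (WithZero (Multiplicative ℤ))) : Prop :=
  Function.Surjective w ∧ ∀ c : k, c ≠ 0 → w (algebraMap k K c) = 1

/-- The place `w` of `F` lies over the place `v` of `K` (along the embedding `f : K → F`)
with ramification index `e`. -/
def LiesOverE {K F : Type*} [Field K] [Field F]
    (w : Valuation F (WithZero (Multiplicative ℤ))) (f : K →+* F)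
    (v : Valuation K (WithZero (Multiplicative ℤ))) (e : ℕ) : Prop :=
  0 < e ∧ ∀ x : K, w (f x) = (v x) ^ e

/-- The place `w` of `F` lies over the place `v` of `K` (along the embedding `f : K → F`). -/
def LiesOver {K F : Type*} [Field K] [Field F]
    (w : Valuation F (WithZero (Multiplicative ℤ))) (f : K →+* F)
    (v : Valuation K (WithZero (Multiplicative ℤ))) : Prop :=
  ∃ e : ℕ, LiesOverE w f v e

section DiscreteValuations

open WithZero

variable {K F : Type*} [Field K] [Field F]

lemma exists_eq_exp (v : Valuation K ℤᵐ⁰) {x : K} (hx : x ≠ 0) : ∃ n : ℤ, v x = exp n :=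
  ⟨log (v x), (exp_log ((Valuation.ne_zero_iff v).2 hx)).symm⟩

lemma ne_zero_of_eq_exp (v : Valuation K ℤᵐ⁰) {x : K} {n : ℤ} (h : v x = exp n) : x ≠ 0 := by
  rintro rfl
  exact exp_ne_zero (h.symm.trans (map_zero v))

lemma exp_pow_nat (n : ℤ) (e : ℕ) : (exp n : ℤᵐ⁰) ^ e = exp (e * n) := by
  rw [← exp_nsmul, nsmul_eq_mul]

/-- A valuation which is nonnegative on the valuation ring of a normalized discrete valuation
is a power of the latter. -/
lemma exists_eq_pow_of_le_one {v w : Valuation K ℤᵐ⁰} (hv : Function.Surjective v)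
    (h : ∀ x, v x ≤ 1 → w x ≤ 1) : ∃ e : ℕ, ∀ x ≠ 0, w x = v x ^ e := by
  obtain ⟨t, ht⟩ := hv (exp (-1))
  have ht0 := ne_zero_of_eq_exp v ht
  obtain ⟨a, ha⟩ := exists_eq_exp w ht0
  have ha0 : a ≤ 0 := by
    have := h t (by rw [ht, ← exp_zero, exp_le_exp]; simp)
    rwa [ha, ← exp_zero, exp_le_exp] at this
  have unit : ∀ y, v y = 1 → w y = 1 := fun y hy ↦ by
    have hy0 : y ≠ 0 := by rintro rfl; simp at hy
    refine le_antisymm (h y hy.le) ?_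
    have := h y⁻¹ (by simp [hy])
    rw [map_inv₀, inv_le_one₀ (zero_lt_iff.2 ((Valuation.ne_zero_iff w).2 hy0))] at this
    exact this
  refine ⟨a.natAbs, fun x hx ↦ ?_⟩
  obtain ⟨n, hn⟩ := exists_eq_exp v hx
  have := unit (x * t ^ n) (by rw [map_mul, map_zpow₀, ht, hn, ← exp_zsmul, ← exp_add]; simp)
  obtain ⟨m, hm⟩ := exists_eq_exp w hx
  rw [map_mul, map_zpow₀, ha, hm, ← exp_zsmul, ← exp_add, exp_eq_one, smul_eq_mul] at this
  rw [hm, hn, exp_pow_nat, exp_inj, Int.natCast_natAbs, abs_of_nonpos ha0]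
  linarith

lemma eq_of_le_one {v w : Valuation K ℤᵐ⁰} (hv : Function.Surjective v)
    (hw : Function.Surjective w) (h : ∀ x, v x ≤ 1 → w x ≤ 1) : v = w := by
  obtain ⟨e, he⟩ := exists_eq_pow_of_le_one hv h
  obtain ⟨x, hx⟩ := hw (exp 1)
  have hx0 := ne_zero_of_eq_exp w hx
  obtain ⟨n, hn⟩ := exists_eq_exp v hx0
  have h1 := he x hx0
  rw [hx, hn, exp_pow_nat, exp_inj] at h1
  have he1 : e = 1 := by
    exact_mod_cast Int.eq_one_of_mul_eq_one_right (Int.natCast_nonneg e) h1.symm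
  ext x
  rcases eq_or_ne x 0 with rfl | hx
  · simp
  · rw [he x hx, he1, pow_one]

lemma liesOver_of_le_one {v : Valuation K ℤᵐ⁰} {w : Valuation F ℤᵐ⁰} {f : K →+* F}
    (hv : Function.Surjective v) (h : ∀ x, v x ≤ 1 → w (f x) ≤ 1) {y : K} (hy : y ≠ 0)
    (hwy : w (f y) ≠ 1) : LiesOver w f v := by
  obtain ⟨e, he⟩ := exists_eq_pow_of_le_one (w := w.comap f) hv h
  have he0 : e ≠ 0 := by
    rintro rfl
    exact hwy (by simpa using he y hy)
  refine ⟨e, Nat.pos_of_ne_zero he0, fun x ↦ ?_⟩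
  rcases eq_or_ne x 0 with rfl | hx
  · simp [he0]
  · exact he x hx

/-- A nontrivial discrete valuation is a positive power of a normalized one. -/
lemma exists_normalization (w : Valuation K ℤᵐ⁰) {y : K} (hy : y ≠ 0) (hwy : w y ≠ 1) :
    ∃ v : Valuation K ℤᵐ⁰, Function.Surjective v ∧ ∃ e : ℕ, 0 < e ∧ ∀ x, w x = v x ^ e := by
  let H : AddSubgroup ℤ :=
    { carrier := {n | ∃ x, w x = exp n}
      add_mem' := by
        rintro a b ⟨x, hx⟩ ⟨y, hy⟩
        exact ⟨x * y, by rw [map_mul, hx, hy, exp_add]⟩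
      zero_mem' := ⟨1, by simp⟩
      neg_mem' := by
        rintro a ⟨x, hx⟩
        exact ⟨x⁻¹, by rw [map_inv₀, hx, exp_neg]⟩ }
  obtain ⟨a, ha⟩ := Int.subgroup_cyclic H
  have hmem : ∀ n, (∃ x, w x = exp n) ↔ a ∣ n := fun n ↦ by
    change n ∈ H ↔ _
    rw [ha, ← AddSubgroup.zmultiples_eq_closure, Int.mem_zmultiples_iff]
  have ha0 : a ≠ 0 := by
    rintro rfl
    obtain ⟨n, hn⟩ := exists_eq_exp w hy
    have := (hmem n).1 ⟨y, hn⟩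
    rw [zero_dvd_iff] at this
    exact hwy (by simp [hn, this])
  set e := a.natAbs with he
  have he0 : e ≠ 0 := by simpa [he] using ha0
  have hroot : ∀ x, ∃ g : ℤᵐ⁰, w x = g ^ e := fun x ↦ by
    rcases eq_or_ne x 0 with rfl | hx
    · exact ⟨0, by simp [he0]⟩
    obtain ⟨n, hn⟩ := exists_eq_exp w hx
    obtain ⟨m, hm⟩ := Int.natAbs_dvd.2 ((hmem n).1 ⟨x, hn⟩)
    exact ⟨exp m, by rw [hn, exp_pow_nat, hm]⟩
  choose g hg using hroot
  have inj : ∀ x y : ℤᵐ⁰, x ^ e = y ^ e → x = y := fun x y h ↦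
    (pow_left_inj₀ zero_le zero_le he0).1 h
  refine ⟨⟨⟨⟨g, ?_⟩, ?_, ?_⟩, ?_⟩, ?_, e, Nat.pos_of_ne_zero he0, hg⟩
  · exact inj _ _ (by rw [← hg]; simp [he0])
  · exact inj _ _ (by rw [← hg]; simp)
  · exact fun x y ↦ inj _ _ (by simp only [mul_pow, ← hg, map_mul])
  · intro x y
    rcases le_max_iff.1 (w.map_add x y) with h | h <;> rw [hg, hg] at h
    · exact le_max_of_le_left ((pow_le_pow_iff_left₀ zero_le zero_le he0).1 h)
    · exact le_max_of_le_right ((pow_le_pow_iff_left₀ zero_le zero_le he0).1 h)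
  · intro γ
    rcases eq_or_ne γ 0 with rfl | hγ
    · exact ⟨0, inj _ _ (by change g 0 ^ e = _; rw [← hg]; simp [he0])⟩
    · obtain ⟨x, hx⟩ := (hmem (e * log γ)).2 (Dvd.dvd.mul_right (Int.dvd_natAbs.2 dvd_rfl) _)
      refine ⟨x, inj _ _ ?_⟩
      change g x ^ e = _
      rw [← hg, hx, ← exp_pow_nat, exp_log hγ]

/-- A normalized discrete valuation of `F` restricting to a power of `v` on `K` lies over a
normalized discrete valuation of any intermediate field. -/
lemma exists_liesOver_intermediate {L : Type*} [Field L] {v : Valuation K ℤᵐ⁰}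
    {w : Valuation F ℤᵐ⁰} {f : K →+* L} {g : L →+* F} (hv : Function.Surjective v)
    (h : LiesOver w (g.comp f) v) :
    ∃ u : Valuation L ℤᵐ⁰, Function.Surjective u ∧ LiesOver w g u ∧ LiesOver u f v := by
  obtain ⟨a, ha, haw⟩ := h
  obtain ⟨s, hs⟩ := hv (exp 1)
  have hs0 := ne_zero_of_eq_exp v hs
  have hws : w (g (f s)) = exp (a : ℤ) := by
    have := haw s
    rwa [hs, exp_pow_nat, mul_one] at this
  have hws1 : w (g (f s)) ≠ 1 := by
    rw [hws, Ne, exp_eq_one]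
    exact_mod_cast ha.ne'
  obtain ⟨u, hu, e, he, hue⟩ := exists_normalization (w.comap g) (y := f s) (by simpa) hws1
  refine ⟨u, hu, ⟨e, he, hue⟩, liesOver_of_le_one hv (fun x hx ↦ ?_) hs0 fun h1 ↦ ?_⟩
  · rw [← pow_le_one_iff he.ne', ← hue]
    change w (g.comp f x) ≤ 1
    rw [haw]
    exact pow_le_one' hx _
  · have := hue (f s)
    rw [h1, one_pow] at this
    exact hws1 this

/-- An element which is large at one of finitely many normalized discrete valuations and small
at all others. -/
lemma exists_one_lt_forall_lt_one [DecidableEq (Valuation F ℤᵐ⁰)]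
    {v : Valuation F ℤᵐ⁰} (hv : Function.Surjective v)
    (T : Finset (Valuation F ℤᵐ⁰)) (hT : ∀ w ∈ T, Function.Surjective w) (hvT : v ∉ T) :
    ∃ x, 1 < v x ∧ ∀ w ∈ T, w x < 1 := by
  induction T using Finset.induction_on with
  | empty =>
    obtain ⟨x, hx⟩ := hv (exp 1)
    exact ⟨x, by rw [hx, ← exp_zero, exp_lt_exp]; simp, by simp⟩
  | insert w T hwT ih =>
    obtain ⟨x, hx, hxT⟩ := ih (fun w hw ↦ hT w (Finset.mem_insert_of_mem hw))
      (fun h ↦ hvT (Finset.mem_insert_of_mem h))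
    have hw := hT w (Finset.mem_insert_self w T)
    have hvw : v ≠ w := fun h ↦ hvT (h ▸ Finset.mem_insert_self w T)
    rcases lt_or_ge (w x) 1 with hwx | hwx
    · exact ⟨x, hx, by simpa [hwx] using hxT⟩
    obtain ⟨b, hb, hb'⟩ : ∃ b, v b ≤ 1 ∧ 1 < w b := by
      by_contra! h
      exact hvw (eq_of_le_one hv hw h)
    obtain ⟨c, hc, hc'⟩ : ∃ c, w c ≤ 1 ∧ 1 < v c := by
      by_contra! h
      exact hvw (eq_of_le_one hw hv h).symm
    have hb0 : 0 < w b := zero_lt_one.trans hb'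
    have hvb0 : 0 < v b := by
      rw [zero_lt_iff, Valuation.ne_zero_iff]
      rintro rfl
      simp at hb0
    have ha : 1 < v (c / b) := by
      rw [map_div₀, one_lt_div₀ hvb0]
      exact hb.trans_lt hc'
    have ha' : w (c / b) < 1 := by
      rw [map_div₀, div_lt_one₀ hb0]
      exact hc.trans_lt hb'
    obtain ⟨y, hvy, hwy, hyT⟩ : ∃ y, 1 ≤ v y ∧ w y = 1 ∧ ∀ u ∈ T, u y < 1 := by
      rcases hwx.eq_or_lt with h | h
      · exact ⟨x, hx.le, h.symm, hxT⟩
      · refine ⟨x / (1 + x), ?_, ?_, fun u hu ↦ ?_⟩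
        · rw [map_div₀, Valuation.map_add_eq_of_lt_right v (by simpa using hx), div_self]
          exact (zero_lt_one.trans hx).ne'
        · rw [map_div₀, Valuation.map_add_eq_of_lt_right w (by simpa using h), div_self]
          exact (zero_lt_one.trans h).ne'
        · rw [map_div₀, Valuation.map_add_eq_of_lt_left u (by simpa using hxT u hu)]
          simpa using hxT u hu
    have hlim : ∀ u ∈ T, ∀ᶠ n : ℕ in Filter.atTop, u (y ^ n * (c / b)) < 1 := fun u hu ↦ by
      have huy := hyT u hu
      rcases eq_or_ne (c / b) 0 with h0 | h0
      · simp [h0]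
      rcases eq_or_ne y 0 with hy0 | hy0
      · filter_upwards [Filter.eventually_ne_atTop 0] with n hn
        simp [hy0, hn]
      obtain ⟨m, hm⟩ := exists_eq_exp u h0
      obtain ⟨l, hl⟩ := exists_eq_exp u hy0
      rw [hl, ← exp_zero, exp_lt_exp] at huy
      filter_upwards [Filter.eventually_gt_atTop m.natAbs] with n hn
      rw [map_mul, map_pow, hl, hm, exp_pow_nat, ← exp_add, ← exp_zero, exp_lt_exp]
      have : (m.natAbs : ℤ) < n := by exact_mod_cast hn
      have := Int.le_natAbs (a := m)
      nlinarith
    obtain ⟨n, hn⟩ := ((Filter.eventually_all_finset T).2 hlim).exists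
    refine ⟨y ^ n * (c / b), ?_, ?_⟩
    · rw [map_mul, map_pow]
      exact ha.trans_le (le_mul_of_one_le_left' (one_le_pow_of_one_le' hvy n))
    · simpa [hwy, Finset.forall_mem_insert] using ⟨by simpa using ha', by simpa using hn⟩

/-- Weak approximation: prescribe the value at `v` and make the other values small. -/
lemma exists_eq_exp_forall_le {v : Valuation F ℤᵐ⁰} (hv : Function.Surjective v)
    (T : Finset (Valuation F ℤᵐ⁰)) (hT : ∀ w ∈ T, Function.Surjective w)
    (j : ℤ) (N : Valuation F ℤᵐ⁰ → ℤ) :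
    ∃ x, v x = exp j ∧ ∀ w ∈ T, w ≠ v → w x ≤ exp (N w) := by
  classical
  obtain ⟨y, hvy, hyT⟩ := exists_one_lt_forall_lt_one hv (T.erase v)
    (fun w hw ↦ hT w (Finset.mem_of_mem_erase hw)) (Finset.notMem_erase v T)
  obtain ⟨t, ht⟩ := hv (exp j)
  have ht0 := ne_zero_of_eq_exp v ht
  have hlim : ∀ w ∈ T.erase v, ∀ᶠ n : ℕ in Filter.atTop,
      w (y ^ n / (1 + y ^ n) * t) ≤ exp (N w) := fun w hw ↦ by
    have hwy := hyT w hw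
    have hy0 : y ≠ 0 := by rintro rfl; simp at hvy
    obtain ⟨l, hl⟩ := exists_eq_exp w hy0
    obtain ⟨m, hm⟩ := exists_eq_exp w ht0
    rw [hl, ← exp_zero, exp_lt_exp] at hwy
    filter_upwards [Filter.eventually_gt_atTop (m - N w).natAbs] with n hn
    have hn0 : n ≠ 0 := by omega
    have hyn : w (y ^ n) < 1 := by
      rw [map_pow]
      exact pow_lt_one' (hyT w hw) hn0
    rw [map_mul, map_div₀, Valuation.map_add_eq_of_lt_left w (by simpa using hyn), map_one,
      div_one, map_pow, hl, hm, exp_pow_nat, ← exp_add, exp_le_exp]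
    have : ((m - N w).natAbs : ℤ) < n := by exact_mod_cast hn
    have := Int.le_natAbs (a := m - N w)
    nlinarith
  obtain ⟨n, hn, hn0⟩ := (((Filter.eventually_all_finset _).2 hlim).and
    (Filter.eventually_ne_atTop 0)).exists
  refine ⟨y ^ n / (1 + y ^ n) * t, ?_, fun w hw hwv ↦ hn w (Finset.mem_erase.2 ⟨hwv, hw⟩)⟩
  have hyn : 1 < v (y ^ n) := by
    rw [map_pow]
    exact one_lt_pow' hvy hn0
  rw [map_mul, map_div₀, Valuation.map_add_eq_of_lt_right v (by simpa using hyn), div_self, one_mul,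
    ht]
  exact (zero_lt_one.trans hyn).ne'

end DiscreteValuations

section Residue

open WithZero Polynomial Algebra

variable {k K F : Type*} [Field k] [Field K] [Field F] [Algebra k K] [Algebra k F]

lemma IsFunctionFieldOver.trdeg_le_one (hK : IsFunctionFieldOver k K) : trdeg k K ≤ 1 := by
  obtain ⟨⟨x, -, hfin⟩, -⟩ := hK
  have : Algebra.IsAlgebraic (adjoin k ({x} : Set K)) K :=
    IntermediateField.isAlgebraic_adjoin_iff_top.1 inferInstance
  simpa using Algebra.IsAlgebraic.trdeg_le_cardinalMk k ({x} : Set K)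

lemma trdeg_le_one_of_isAlgebraic [Algebra K F] [IsScalarTower k K F] [Algebra.IsAlgebraic K F]
    (hK : trdeg k K ≤ 1) : trdeg k F ≤ 1 := by
  have h := lift_trdeg_add_eq k K F
  rw [trdeg_eq_zero (R := K) (A := F), Cardinal.lift_zero, add_zero] at h
  rw [← Cardinal.lift_le_one_iff, ← h]
  simpa using hK

/-- A valuation which is trivial on a subring is trivial on each algebraic extension of it. -/
lemma le_one_of_isAlgebraic {A : Subalgebra k F} [Algebra.IsAlgebraic A F] (v : Valuation F ℤᵐ⁰)
    (hA : ∀ a ∈ A, a ≠ 0 → v a = 1) (y : F) : v y ≤ 1 := by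
  by_contra! hy
  obtain ⟨p, hp, hpy⟩ := Algebra.IsAlgebraic.isAlgebraic (R := A) y
  have hlead : v (algebraMap A F p.leadingCoeff) = 1 :=
    hA _ p.leadingCoeff.2 (by simpa using hp)
  rw [aeval_eq_sum_range, Finset.sum_range_succ] at hpy
  have hlt : v (∑ i ∈ Finset.range p.natDegree, p.coeff i • y ^ i) < v y ^ p.natDegree := by
    refine Valuation.map_sum_lt v (pow_ne_zero _ (zero_lt_one.trans hy).ne') fun i hi ↦ ?_
    rw [Algebra.smul_def, map_mul, map_pow]
    refine lt_of_le_of_lt (mul_le_of_le_one_left' ?_)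
      (pow_lt_pow_right₀ hy (Finset.mem_range.1 hi))
    rcases eq_or_ne (algebraMap A F (p.coeff i)) 0 with h0 | h0
    · simp [h0]
    · exact (hA _ (p.coeff i).2 h0).le
  rw [eq_neg_of_add_eq_zero_left hpy, Valuation.map_neg, Algebra.smul_def, map_mul,
    ← leadingCoeff, hlead, one_mul, map_pow] at hlt
  exact lt_irrefl _ hlt

/-- The residue field of a place of a function field over an algebraically closed field is the
constant field. -/
lemma exists_algebraMap_sub_lt_one [IsAlgClosed k] (hF : trdeg k F ≤ 1) {v : Valuation F ℤᵐ⁰}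
    (hv : IsPlace (k := k) v) {u : F} (hu : v u ≤ 1) : ∃ a : k, v (u - algebraMap k F a) < 1 := by
  by_contra! h
  have hlin : ∀ a : k, v (u - algebraMap k F a) = 1 := fun a ↦ by
    refine le_antisymm ((v.map_sub _ _).trans (max_le hu ?_)) (h a)
    rcases eq_or_ne a 0 with rfl | ha
    · simp
    · exact (hv.2 a ha).le
  have hpoly : ∀ p : k[X], p ≠ 0 → v (aeval u p) = 1 := fun p hp ↦ by
    rw [(IsAlgClosed.splits p).eq_prod_roots, map_mul, map_mul, aeval_C,
      hv.2 _ (leadingCoeff_ne_zero.2 hp), one_mul, map_multiset_prod, map_multiset_prod,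
      Multiset.map_map, Multiset.map_map]
    refine Multiset.prod_eq_one fun x hx ↦ ?_
    obtain ⟨a, -, rfl⟩ := Multiset.mem_map.1 hx
    simpa using hlin a
  have htr : Transcendental k u := fun ⟨p, hp, h0⟩ ↦ by simpa [h0] using hpoly p hp
  have hind : AlgebraicIndependent k (fun _ : Unit ↦ u) :=
    (algebraicIndependent_unique_type_iff (R := k)).2 htr
  have hb := hind.isTranscendenceBasis_of_lift_trdeg_le_of_finite (by simpa using hF)
  have := hb.isAlgebraic
  obtain ⟨y, hy⟩ := hv.1 (exp 1)
  have := le_one_of_isAlgebraic (A := adjoin k (Set.range fun _ : Unit ↦ u)) v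
    (fun a ha ha0 ↦ by
      rw [Set.range_const, adjoin_singleton_eq_range_aeval] at ha
      obtain ⟨p, rfl⟩ := ha
      exact hpoly p (by rintro rfl; simp at ha0)) y
  rw [hy, ← exp_zero, exp_le_exp] at this
  exact absurd this (by norm_num)

end Residue

section FundamentalIdentity

open WithZero IsDedekindDomain

variable {M F : Type*} [Field M] [Field F]

lemma isDiscreteValuationRing_valuationSubring {v : Valuation M ℤᵐ⁰}
    (hv : Function.Surjective v) : IsDiscreteValuationRing v.valuationSubring := by
  obtain ⟨t, ht⟩ := hv (exp (-1))
  have ht0 := ne_zero_of_eq_exp v ht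
  let τ : v.valuationSubring := ⟨t, by
    rw [Valuation.mem_valuationSubring_iff, ht, ← exp_zero, exp_le_exp]; simp⟩
  have hunit : ∀ x : v.valuationSubring, v x = 1 → IsUnit x := fun x hx ↦ by
    refine IsUnit.of_mul_eq_one ⟨(x : M)⁻¹, ?_⟩ ?_
    · rw [Valuation.mem_valuationSubring_iff, map_inv₀, hx, inv_one]
    · ext
      have : (x : M) ≠ 0 := by intro h; simp [h] at hx
      simp [this]
  have hunit' : ∀ x : v.valuationSubring, IsUnit x → v x = 1 := fun x hx ↦ by
    obtain ⟨y, hy⟩ := hx.exists_right_inv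
    have h1 := congr_arg (fun z : v.valuationSubring ↦ v z) hy
    simp only [MulMemClass.coe_mul, map_mul, OneMemClass.coe_one, map_one] at h1
    exact eq_one_of_one_le_mul_left x.2 y.2 h1.ge
  refine IsDiscreteValuationRing.ofHasUnitMulPowIrreducibleFactorization
    ⟨τ, ⟨fun h ↦ ?_, fun a b hab ↦ ?_⟩, fun {x} hx ↦ ?_⟩
  · have := hunit' _ h
    change v t = 1 at this
    rw [ht, exp_eq_one] at this
    omega
  · by_contra! hcon
    have hlt : ∀ c : v.valuationSubring, ¬ IsUnit c → v c ≤ exp (-1) := fun c hc ↦ by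
      rcases eq_or_ne (c : M) 0 with h0 | h0
      · simp [h0]
      obtain ⟨n, hn⟩ := exists_eq_exp v h0
      have h1 : v c ≤ 1 := c.2
      have h2 : v c ≠ 1 := fun h ↦ hc (hunit c h)
      rw [hn, ← exp_zero, exp_le_exp] at h1
      rw [hn, Ne, exp_eq_one] at h2
      rw [hn, exp_le_exp]
      omega
    have h1 := congr_arg (fun z : v.valuationSubring ↦ v z) hab
    simp only [MulMemClass.coe_mul, map_mul] at h1
    have h2 := mul_le_mul' (hlt a hcon.1) (hlt b hcon.2)
    rw [← h1, ← exp_add] at h2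
    change v t ≤ _ at h2
    rw [ht, exp_le_exp] at h2
    omega
  · have hx0 : (x : M) ≠ 0 := by simpa using hx
    obtain ⟨n, hn⟩ := exists_eq_exp v hx0
    have h1 : v x ≤ 1 := x.2
    rw [hn, ← exp_zero, exp_le_exp] at h1
    have hz : v ((x : M) * t ^ n) = 1 := by
      rw [map_mul, map_zpow₀, ht, hn, ← exp_zsmul, ← exp_add]; simp
    obtain ⟨u, hu⟩ := hunit ⟨x * t ^ n, hz.le⟩ hz
    refine ⟨n.natAbs, u, ?_⟩
    ext
    have hnn : (n.natAbs : ℤ) = -n := by omega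
    rw [hu]
    change t ^ n.natAbs * (x * t ^ n) = x
    rw [← zpow_natCast, hnn, zpow_neg]
    field_simp

/-- The fundamental identity `∑ e = [F : M]` for the places of a finite separable extension
over a given place of the base, when there is no residue field extension. -/
lemma exists_places_sum_eq_finrank {k : Type*} [Field k] [IsAlgClosed k] [Algebra k M]
    [Algebra k F] [Algebra M F] [IsScalarTower k M F] [FiniteDimensional M F]
    [Algebra.IsSeparable M F] (hF : Algebra.trdeg k F ≤ 1)
    {R : Valuation M ℤᵐ⁰} (hR : IsPlace (k := k) R) :
    ∃ (T : Finset (Valuation F ℤᵐ⁰)) (e : Valuation F ℤᵐ⁰ → ℕ),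
      (∀ Q ∈ T, IsPlace (k := k) Q ∧ LiesOverE Q (algebraMap M F) R (e Q)) ∧
      ∑ Q ∈ T, e Q = Module.finrank M F := by
  classical
  have := isDiscreteValuationRing_valuationSubring hR.1
  let A := R.valuationSubring
  let B := integralClosure A F
  have : IsDedekindDomain B := integralClosure.isDedekindDomain A M F
  have : Module.Finite A B := IsIntegralClosure.finite A M F B
  have : IsFractionRing B F := integralClosure.isFractionRing_of_finite_extension M F
  have hrank : Module.finrank A B = Module.finrank M F := IsIntegralClosure.rank A M F B
  let p := IsLocalRing.maximalIdeal A
  let P : HeightOneSpectrum A := IsDiscreteValuationRing.maximalIdeal A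
  have hp0 : p ≠ ⊥ := P.ne_bot
  have hPR : P.valuation M = R := (eq_of_le_one hR.1 (P.valuation_surjective M) fun x hx ↦
    P.valuation_le_one (⟨x, hx⟩ : A)).symm
  have : Finite (p.primesOver B) := inferInstance
  have := Fintype.ofFinite (p.primesOver B)
  have : p.IsMaximal := IsLocalRing.maximalIdeal.isMaximal A
  let H : p.primesOver B → HeightOneSpectrum B := fun q ↦
    ⟨q.1, q.2.1, Ideal.ne_bot_of_mem_primesOver hp0 q.2⟩
  have hover : ∀ q : p.primesOver B, (H q).asIdeal.LiesOver P.asIdeal := fun q ↦ q.2.2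
  have key : ∀ q : p.primesOver B, IsPlace (k := k) ((H q).valuation F) ∧
      LiesOverE ((H q).valuation F) (algebraMap M F) R (q.1.ramificationIdx A) := fun q ↦ by
    have := hover q
    have : (q.1).IsPrime := q.2.1
    have : (q.1).LiesOver p := q.2.2
    have hval : ∀ x, (H q).valuation F (algebraMap M F x) = R x ^ q.1.ramificationIdx A := by
      intro x
      rw [← DFunLike.congr_fun hPR x, ← Ideal.ramificationIdx'_eq_ramificationIdx p q.1 hp0]
      exact (HeightOneSpectrum.valuation_liesOver F P (H q) x).symm
    refine ⟨⟨(H q).valuation_surjective F, fun c hc ↦ ?_⟩, Nat.pos_of_ne_zero ?_, hval⟩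
    · rw [IsScalarTower.algebraMap_apply k M F, hval, hR.2 c hc, one_pow]
    · rw [← Ideal.ramificationIdx'_eq_ramificationIdx p q.1 hp0]
      exact Ideal.IsDedekindDomain.ramificationIdx'_ne_zero_of_liesOver (H q).asIdeal P.ne_bot
  have hinertia : ∀ q : p.primesOver B, q.1.inertiaDeg A = 1 := fun q ↦ by
    have : (q.1).LiesOver p := q.2.2
    have : (q.1).IsPrime := q.2.1
    rw [Ideal.inertiaDeg_eq_of_isMaximal p]
    refine finrank_eq_one 1 one_ne_zero fun y ↦ ?_
    obtain ⟨b, rfl⟩ := Ideal.Quotient.mk_surjective y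
    obtain ⟨a, ha⟩ := exists_algebraMap_sub_lt_one hF (key q).1
      ((H q).valuation_le_one (K := F) b)
    have haA : R (algebraMap k M a) ≤ 1 := by
      rcases eq_or_ne a 0 with rfl | h
      · simp
      · exact (hR.2 a h).le
    refine ⟨Ideal.Quotient.mk p ⟨algebraMap k M a, haA⟩, ?_⟩
    rw [Algebra.smul_def, mul_one, Ideal.Quotient.algebraMap_mk_of_liesOver, eq_comm,
      Ideal.Quotient.mk_eq_mk_iff_sub_mem]
    change _ ∈ (H q).asIdeal
    rw [← (H q).valuation_lt_one_iff_mem (K := F)]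
    rwa [IsScalarTower.algebraMap_apply k M F] at ha
  have hinj : Function.Injective (fun q ↦ (H q).valuation F) := fun q q' h ↦ by
    ext b
    change b ∈ (H q).asIdeal ↔ b ∈ (H q').asIdeal
    rw [← (H q).valuation_lt_one_iff_mem (K := F), ← (H q').valuation_lt_one_iff_mem (K := F)]
    exact iff_of_eq (congr_arg (fun v : Valuation F ℤᵐ⁰ ↦ v (algebraMap B F b) < 1) h)
  let e : Valuation F ℤᵐ⁰ → ℕ :=
    Function.extend (fun q ↦ (H q).valuation F) (fun q ↦ q.1.ramificationIdx A) 0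
  have he : ∀ q, e ((H q).valuation F) = q.1.ramificationIdx A := hinj.extend_apply _ _
  refine ⟨Finset.univ.image fun q ↦ (H q).valuation F, e, fun Q hQ ↦ ?_, ?_⟩
  · obtain ⟨q, -, rfl⟩ := Finset.mem_image.1 hQ
    rw [he]
    exact key q
  · rw [Finset.sum_image hinj.injOn, ← hrank, ← Ideal.sum_ramification_inertia_eq_finrank p B]
    exact Finset.sum_congr rfl fun q _ ↦ by rw [he, hinertia, mul_one]

end FundamentalIdentity

section Independence

open WithZero

variable {M ι : Type*} [Field M] [Fintype ι] {G : ι → Type*} [∀ i, Field (G i)]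
  [∀ i, Algebra M (G i)]

lemma le_exp_neg_one_of_lt_one {x : ℤᵐ⁰} (hx : x < 1) : x ≤ exp (-1) := by
  rcases eq_or_ne x 0 with rfl | h
  · simp
  · rw [← exp_log h, ← exp_zero, exp_lt_exp] at hx
    rw [← exp_log h, exp_le_exp]
    omega

/-- The index set of a basis adapted to the places in `T`, with ramification indices `ε`. -/
abbrev RamificationIndexSet (T : ∀ i, Finset (Valuation (G i) ℤᵐ⁰))
    (ε : ∀ i, Valuation (G i) ℤᵐ⁰ → ℕ) : Type _ :=
  Σ i, Σ Q : T i, Fin (ε i Q)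

lemma card_ramificationIndexSet (T : ∀ i, Finset (Valuation (G i) ℤᵐ⁰))
    (ε : ∀ i, Valuation (G i) ℤᵐ⁰ → ℕ) :
    Fintype.card (RamificationIndexSet T ε) = ∑ i, ∑ Q ∈ T i, ε i Q := by
  rw [Fintype.card_sigma]
  refine Finset.sum_congr rfl fun i _ ↦ ?_
  rw [Fintype.card_sigma, ← Finset.sum_coe_sort (T i) (ε i)]
  simp only [Fintype.card_fin]

/-- There is a family, indexed by the places in `T` with multiplicities given by the ramification
indices over `R`, none of whose primitive integral combinations is small at all these places. -/
lemma exists_primitive_independent {R : Valuation M ℤᵐ⁰}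
    {T : ∀ i, Finset (Valuation (G i) ℤᵐ⁰)} {ε : ∀ i, Valuation (G i) ℤᵐ⁰ → ℕ}
    (hT : ∀ i, ∀ Q ∈ T i, Function.Surjective Q ∧ LiesOverE Q (algebraMap M (G i)) R (ε i Q)) :
    ∃ z : RamificationIndexSet T ε → ∀ i, G i, ∀ m : RamificationIndexSet T ε → M,
      (∀ a, R (m a) ≤ 1) → (∃ a, R (m a) = 1) →
      ∃ i, ∃ Q ∈ T i, exp (-(ε i Q : ℤ)) < Q ((∑ a, m a • z a) i) := by
  classical
  have hx : ∀ a : RamificationIndexSet T ε, ∃ x : G a.1, a.2.1.1 x = exp (-(a.2.2 : ℤ)) ∧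
      ∀ Q ∈ T a.1, Q ≠ a.2.1.1 → Q x ≤ exp (-(ε a.1 Q : ℤ)) := fun a ↦
    exists_eq_exp_forall_le (hT _ _ a.2.1.2).1 (T a.1) (fun Q hQ ↦ (hT _ _ hQ).1) _ _
  choose x hx hx' using hx
  replace hx : ∀ i (Q : T i) (j : Fin (ε i Q)), Q.1 (x ⟨i, Q, j⟩) = exp (-(j : ℤ)) :=
    fun i Q j ↦ hx ⟨i, Q, j⟩
  refine ⟨fun a ↦ Pi.single a.1 (x a), fun m hm ⟨⟨i, Q, j'⟩, hj'⟩ ↦ ?_⟩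
  obtain ⟨j, hj, hmin⟩ : ∃ j, R (m ⟨i, Q, j⟩) = 1 ∧ ∀ l < j, R (m ⟨i, Q, l⟩) ≠ 1 := by
    obtain ⟨j, hj, hmin⟩ := WellFounded.has_min (wellFounded_lt (α := Fin (ε i Q)))
      {j | R (m ⟨i, Q, j⟩) = 1} ⟨j', hj'⟩
    exact ⟨j, hj, fun l hl h ↦ hmin l h hl⟩
  obtain ⟨-, hε, hQR⟩ := hT i Q Q.2
  have hjε : exp (-(ε i Q : ℤ)) < exp (-(j : ℤ)) := by
    rw [exp_lt_exp]
    have := j.2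
    omega
  have hmQ : ∀ a, Q.1 (algebraMap M (G i) (m a)) ≤ 1 := fun a ↦ by
    rw [hQR]
    exact pow_le_one' (hm a) _
  refine ⟨i, Q, Q.2, ?_⟩
  rw [← Finset.add_sum_erase _ _ (Finset.mem_univ (⟨i, Q, j⟩ : RamificationIndexSet T ε)),
    Pi.add_apply, Finset.sum_apply]
  have hmain : Q.1 ((m ⟨i, Q, j⟩ • Pi.single (M := G) i (x ⟨i, Q, j⟩) : ∀ i, G i) i) =
      exp (-(j : ℤ)) := by
    rw [Pi.smul_apply, Pi.single_eq_same, Algebra.smul_def, map_mul, hQR, hj, one_pow, one_mul, hx]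
  have hrest : Q.1 (∑ a ∈ Finset.univ.erase (⟨i, Q, j⟩ : RamificationIndexSet T ε),
      (m a • Pi.single (M := G) a.1 (x a) : ∀ i, G i) i) < exp (-(j : ℤ)) := by
    refine Valuation.map_sum_lt _ exp_ne_zero fun a ha ↦ ?_
    obtain ⟨i', Q', l⟩ := a
    rw [Pi.smul_apply, Algebra.smul_def, map_mul]
    rcases eq_or_ne i' i with rfl | hi
    swap
    · rw [Pi.single_eq_of_ne hi.symm]
      simp
    rw [Pi.single_eq_same]
    rcases eq_or_ne Q' Q with rfl | hQ
    swap
    · refine (mul_le_of_le_one_left' (hmQ _)).trans_lt (lt_of_le_of_lt ?_ hjε)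
      exact hx' ⟨i', Q', l⟩ Q Q.2 fun h ↦ hQ (Subtype.ext h.symm)
    rcases lt_trichotomy l j with hlj | rfl | hlj
    · refine lt_of_le_of_lt ?_ hjε
      refine (mul_le_of_le_one_right' ?_).trans ?_
      · rw [hx, ← exp_zero, exp_le_exp]
        simp
      · rw [hQR]
        have hlt := (hm ⟨i', Q', l⟩).lt_of_ne (hmin l hlj)
        refine (pow_le_pow_left' (le_exp_neg_one_of_lt_one hlt) _).trans ?_
        rw [exp_pow_nat, exp_le_exp]
        simp
    · simp at ha
    · refine (mul_le_of_le_one_left' (hmQ _)).trans_lt ?_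
      rw [hx, exp_lt_exp]
      have : (j : ℕ) < l := hlj
      simpa using this
  rw [Valuation.map_add_eq_of_lt_left _ (hrest.trans_eq hmain.symm), hmain]
  exact hjε

lemma exists_smul_primitive {κ : Type*} [Finite κ] (R : Valuation M ℤᵐ⁰) {m : κ → M}
    (hm : m ≠ 0) : ∃ c : M, (∀ a, R (c * m a) ≤ 1) ∧ ∃ a, R (c * m a) = 1 := by
  obtain ⟨b, hb⟩ := Function.ne_iff.1 hm
  have : Nonempty κ := ⟨b⟩
  obtain ⟨a, ha⟩ := Finite.exists_max (fun a ↦ R (m a))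
  have ha0 : 0 < R (m a) := (zero_lt_iff.2 ((Valuation.ne_zero_iff R).2 hb)).trans_le (ha b)
  refine ⟨(m a)⁻¹, fun a' ↦ ?_, a, ?_⟩
  · rw [map_mul, map_inv₀, inv_mul_le_one₀ ha0]
    exact ha a'
  · rw [map_mul, map_inv₀, inv_mul_cancel₀ ha0.ne']

/-- If every element can be approximated by `M`-combinations of `N` elements at all places in `T`,
then the ramification indices of these places over `R` sum up to at most `N`. -/
lemma sum_ramification_le_of_approximation {R : Valuation M ℤᵐ⁰}
    {T : ∀ i, Finset (Valuation (G i) ℤᵐ⁰)} {ε : ∀ i, Valuation (G i) ℤᵐ⁰ → ℕ}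
    (hT : ∀ i, ∀ Q ∈ T i, Function.Surjective Q ∧ LiesOverE Q (algebraMap M (G i)) R (ε i Q))
    {N : ℕ} (t : Fin N → ∀ i, G i)
    (ht : ∀ y : ∀ i, G i, ∃ m : Fin N → M, ∀ i, ∀ Q ∈ T i,
      Q ((y - ∑ j, m j • t j) i) ≤ exp (-(ε i Q : ℤ))) :
    ∑ i, ∑ Q ∈ T i, ε i Q ≤ N := by
  obtain ⟨z, hz⟩ := exists_primitive_independent hT
  choose m hm using fun a ↦ ht (z a)
  by_contra! h
  rw [← card_ramificationIndexSet] at h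
  obtain ⟨g, hg, a, ha⟩ : ∃ g : RamificationIndexSet T ε → M, ∑ a, g a • m a = 0 ∧
      ∃ a, g a ≠ 0 := by
    by_contra! hcon
    have hli := (Fintype.linearIndependent_iff (R := M) (v := m)).2 hcon
    have := hli.fintype_card_le_finrank
    rw [Module.finrank_fin_fun] at this
    omega
  obtain ⟨c, hc, hc'⟩ := exists_smul_primitive R (m := g) (fun h ↦ ha (by simp [h]))
  obtain ⟨i, Q, hQ, hlt⟩ := hz (fun a ↦ c * g a) hc hc'
  refine hlt.not_ge ?_
  have hsum : ∑ a, (c * g a) • z a = ∑ a, (c * g a) • (z a - ∑ j, m a j • t j) := by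
    simp_rw [smul_sub, Finset.sum_sub_distrib, Finset.smul_sum]
    rw [Finset.sum_comm]
    have : ∀ j, ∑ a, (c * g a) • m a j • t j = 0 := fun j ↦ by
      have hj := congr_fun hg j
      simp only [Finset.sum_apply, Pi.smul_apply, smul_eq_mul, Pi.zero_apply] at hj
      simp_rw [smul_smul, ← Finset.sum_smul, mul_assoc, ← Finset.mul_sum, hj, mul_zero, zero_smul]
    simp [this]
  rw [hsum, Finset.sum_apply]
  refine Valuation.map_sum_le _ fun a _ ↦ ?_
  rw [Pi.smul_apply, Algebra.smul_def, map_mul, (hT i Q hQ).2.2]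
  exact (mul_le_of_le_one_left' (pow_le_one' (hc a) _)).trans (hm a i Q hQ)

lemma sum_ramification_le_finrank {F : Type*} [Field F] [Algebra M F] [FiniteDimensional M F]
    {R : Valuation M ℤᵐ⁰} {T : Finset (Valuation F ℤᵐ⁰)} {ε : Valuation F ℤᵐ⁰ → ℕ}
    (hT : ∀ Q ∈ T, Function.Surjective Q ∧ LiesOverE Q (algebraMap M F) R (ε Q)) :
    ∑ Q ∈ T, ε Q ≤ Module.finrank M F := by
  let b := Module.finBasis M F
  have := sum_ramification_le_of_approximation (ι := Unit) (G := fun _ ↦ F) (T := fun _ ↦ T)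
    (ε := fun _ ↦ ε) (fun _ ↦ hT) (fun j _ ↦ b j) fun y ↦ ⟨b.repr (y ()), fun _ Q _ ↦ by
      simp [b.sum_repr]⟩
  simpa using this

end Independence

section Compositum

open WithZero

variable {k K L M : Type*} [Field k] [IsAlgClosed k] [Field K] [Field L] [Field M]
  [Algebra k K] [Algebra k L] [Algebra K L] [Algebra K M] [IsScalarTower k K L]

/-- A place `P` of `L` over a place `S` of `K`: each element of `L` is approximated at `P` by
`K`-combinations of the first `e(P/S)` powers of a uniformizer. -/
lemma exists_approximation (hL : Algebra.trdeg k L ≤ 1) {S : Valuation K ℤᵐ⁰}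
    {P : Valuation L ℤᵐ⁰} (hS : Function.Surjective S) (hP : IsPlace (k := k) P) {e : ℕ}
    (h : LiesOverE P (algebraMap K L) S e) {t : L} (ht : P t = exp (-1)) (B : ℤ) (y : L) :
    ∃ c : Fin e → K, P (y - ∑ j, algebraMap K L (c j) * t ^ (j : ℕ)) ≤ exp B := by
  obtain ⟨he, hPS⟩ := h
  obtain ⟨s, hs⟩ := hS (exp (-1))
  have ht0 := ne_zero_of_eq_exp P ht
  have hs0 := ne_zero_of_eq_exp S hs
  have step : ∀ (n : ℤ) (y : L), P y ≤ exp n →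
      ∃ c : Fin e → K, P (y - ∑ j, algebraMap K L (c j) * t ^ (j : ℕ)) ≤ exp (n - 1) := by
    intro n y hy
    rcases hy.lt_or_eq with hlt | heq
    · refine ⟨0, ?_⟩
      rcases eq_or_ne y 0 with rfl | hy0
      · simp
      obtain ⟨l, hl⟩ := exists_eq_exp P hy0
      rw [hl, exp_lt_exp] at hlt
      simp only [Pi.zero_apply, map_zero, zero_mul, Finset.sum_const_zero, sub_zero]
      rw [hl, exp_le_exp]
      omega
    · have he' : (0 : ℤ) < e := by exact_mod_cast he
      set q := (-n) / e with hq
      have hr0 := Int.emod_nonneg (-n) he'.ne'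
      obtain ⟨r, hr⟩ := Int.eq_ofNat_of_zero_le hr0
      have hre : r < e := by
        have := Int.emod_lt_of_pos (-n) he'
        omega
      have hn : e * q + r = -n := by
        rw [← hr]
        exact Int.mul_ediv_add_emod _ _
      set w : L := algebraMap K L (s ^ q) * t ^ r with hw
      have hPw : P w = exp n := by
        rw [hw, map_mul, hPS, map_zpow₀, hs, map_pow, ht, ← exp_zsmul, exp_pow_nat, exp_pow_nat,
          ← exp_add, exp_inj]
        simp only [smul_eq_mul]
        linarith
      have hw0 := ne_zero_of_eq_exp P hPw
      obtain ⟨a, ha⟩ := exists_algebraMap_sub_lt_one hL hP (u := y / w) (by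
        rw [map_div₀, heq, hPw, div_self exp_ne_zero])
      refine ⟨Pi.single ⟨r, hre⟩ (algebraMap k K a * s ^ q), ?_⟩
      rw [Finset.sum_eq_single ⟨r, hre⟩ (fun j _ hj ↦ by simp [Pi.single_eq_of_ne hj])
        (fun h ↦ absurd (Finset.mem_univ _) h), Pi.single_eq_same]
      have : y - algebraMap K L (algebraMap k K a * s ^ q) * t ^ r =
          w * (y / w - algebraMap k L a) := by
        rw [mul_sub, mul_div_cancel₀ _ hw0, map_mul, ← IsScalarTower.algebraMap_apply k K L, hw]
        ring
      rw [this, map_mul, hPw, sub_eq_add_neg n, exp_add]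
      exact mul_le_mul_right (le_exp_neg_one_of_lt_one ha) _
  have iter : ∀ (d : ℕ) (n : ℤ) (y : L), P y ≤ exp n →
      ∃ c : Fin e → K, P (y - ∑ j, algebraMap K L (c j) * t ^ (j : ℕ)) ≤ exp (n - d) := by
    intro d
    induction d with
    | zero => exact fun n y hy ↦ ⟨0, by simpa using hy⟩
    | succ d ih =>
      intro n y hy
      obtain ⟨c, hc⟩ := step n y hy
      obtain ⟨c', hc'⟩ := ih _ _ hc
      refine ⟨c + c', ?_⟩
      convert hc' using 2
      · simp only [Pi.add_apply, map_add, add_mul, Finset.sum_add_distrib]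
        ring
      · push_cast
        ring
  obtain ⟨n, hn⟩ : ∃ n : ℤ, P y ≤ exp n := by
    rcases eq_or_ne y 0 with rfl | hy
    · exact ⟨0, by simp⟩
    · obtain ⟨n, hn⟩ := exists_eq_exp P hy
      exact ⟨n, hn.le⟩
  obtain ⟨c, hc⟩ := iter (n - B).toNat n y hn
  refine ⟨c, hc.trans ?_⟩
  rw [exp_le_exp]
  omega

variable {ι : Type*} [Fintype ι] {F : ι → Type*} [∀ i, Field (F i)]
  [∀ i, Algebra K (F i)] [∀ i, Algebra L (F i)] [∀ i, Algebra M (F i)]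
  [∀ i, IsScalarTower K L (F i)] [∀ i, IsScalarTower K M (F i)]

/-- The places over both `P` and `R` contribute at most `e(P/S)` to the ramification over `R`. -/
lemma sum_ramification_le_ramification (hL : Algebra.trdeg k L ≤ 1)
    (e : (L ⊗[K] M) ≃ₐ[K] ((i : ι) → F i))
    (he : ∀ (i : ι) (l : L) (m : M),
      e (l ⊗ₜ[K] m) i = algebraMap L (F i) l * algebraMap M (F i) m)
    {S : Valuation K ℤᵐ⁰} {P : Valuation L ℤᵐ⁰} {R : Valuation M ℤᵐ⁰}
    (hS : Function.Surjective S) (hP : IsPlace (k := k) P) {eP : ℕ}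
    (hPS : LiesOverE P (algebraMap K L) S eP)
    {T : ∀ i, Finset (Valuation (F i) ℤᵐ⁰)} {ε : ∀ i, Valuation (F i) ℤᵐ⁰ → ℕ}
    (hT : ∀ i, ∀ Q ∈ T i, Function.Surjective Q ∧ LiesOver Q (algebraMap L (F i)) P ∧
      LiesOverE Q (algebraMap M (F i)) R (ε i Q)) :
    ∑ i, ∑ Q ∈ T i, ε i Q ≤ eP := by
  obtain ⟨t, ht⟩ := hP.1 (exp (-1))
  refine sum_ramification_le_of_approximation (R := R)
    (fun i Q hQ ↦ ⟨(hT i Q hQ).1, (hT i Q hQ).2.2⟩)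
    (fun j i ↦ algebraMap L (F i) (t ^ (j : ℕ))) fun y ↦ ?_
  obtain ⟨w, rfl⟩ := e.surjective y
  induction w using TensorProduct.induction_on with
  | zero => exact ⟨0, fun i Q _ ↦ by simp⟩
  | add w w' h h' =>
    obtain ⟨m, hm⟩ := h
    obtain ⟨m', hm'⟩ := h'
    refine ⟨m + m', fun i Q hQ ↦ ?_⟩
    convert Valuation.map_add_le Q (hm i Q hQ) (hm' i Q hQ) using 2
    simp only [map_add, Pi.add_apply, Pi.sub_apply, add_smul, Finset.sum_add_distrib]
    ring
  | tmul l m =>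
    rcases eq_or_ne m 0 with rfl | hm0
    · exact ⟨0, fun i Q _ ↦ by simp⟩
    have hB : ∀ i, ∀ Q ∈ T i, ∀ᶠ B : ℕ in Filter.atTop, ∀ x : L, P x ≤ exp (-(B : ℤ)) →
        Q (algebraMap L (F i) x * algebraMap M (F i) m) ≤ exp (-(ε i Q : ℤ)) := by
      intro i Q hQ
      obtain ⟨-, ⟨a, ha, haQ⟩, -⟩ := hT i Q hQ
      obtain ⟨b, hb⟩ := exists_eq_exp Q (x := algebraMap M (F i) m) (by simpa using hm0)
      filter_upwards [Filter.eventually_ge_atTop (b + ε i Q).toNat] with B hBb x hx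
      rw [map_mul, haQ, hb]
      refine (mul_le_mul_left (pow_le_pow_left' hx a) _).trans ?_
      rw [exp_pow_nat, ← exp_add, exp_le_exp]
      have h1 : (1 : ℤ) ≤ a := by exact_mod_cast ha
      have h2 : b + ε i Q ≤ (B : ℤ) := Int.toNat_le.1 hBb
      nlinarith
    have hB' : ∀ᶠ B : ℕ in Filter.atTop, ∀ i, ∀ Q ∈ T i, ∀ x : L, P x ≤ exp (-(B : ℤ)) →
        Q (algebraMap L (F i) x * algebraMap M (F i) m) ≤ exp (-(ε i Q : ℤ)) :=
      Filter.eventually_all.2 fun i ↦ (Filter.eventually_all_finset _).2 (hB i)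
    obtain ⟨B, hB⟩ := hB'.exists
    obtain ⟨c, hc⟩ := exists_approximation hL hS hP hPS ht (-(B : ℤ)) l
    refine ⟨fun j ↦ algebraMap K M (c j) * m, fun i Q hQ ↦ ?_⟩
    convert hB i Q hQ _ hc using 2
    rw [Pi.sub_apply, he, Finset.sum_apply, map_sub, sub_mul, map_sum, Finset.sum_mul]
    congr 1
    refine Finset.sum_congr rfl fun j _ ↦ ?_
    rw [Pi.smul_apply, Algebra.smul_def, map_mul, map_mul,
      ← IsScalarTower.algebraMap_apply K M (F i), ← IsScalarTower.algebraMap_apply K L (F i)]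
    ring

end Compositum

section Main

open WithZero

lemma LiesOverE.unique {K F : Type*} [Field K] [Field F] {w : Valuation F ℤᵐ⁰} {f : K →+* F}
    {v : Valuation K ℤᵐ⁰} (hv : Function.Surjective v) {a b : ℕ} (ha : LiesOverE w f v a)
    (hb : LiesOverE w f v b) : a = b := by
  obtain ⟨x, hx⟩ := hv (exp 1)
  have := (ha.2 x).symm.trans (hb.2 x)
  rw [hx, exp_pow_nat, exp_pow_nat, exp_inj] at this
  simpa using this

lemma LiesOverE.comp {K M F : Type*} [Field K] [Field M] [Field F] {w : Valuation F ℤᵐ⁰}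
    {u : Valuation M ℤᵐ⁰} {v : Valuation K ℤᵐ⁰} {g : M →+* F} {f : K →+* M} {a b : ℕ}
    (ha : LiesOverE w g u a) (hb : LiesOverE u f v b) : LiesOverE w (g.comp f) v (a * b) :=
  ⟨Nat.mul_pos ha.1 hb.1, fun x ↦ by
    rw [RingHom.comp_apply, ha.2, hb.2, ← pow_mul, mul_comm]⟩

lemma isPlace_of_liesOver {k L F : Type*} [Field k] [Field L] [Field F] [Algebra k L] [Algebra k F]
    [Algebra L F] [IsScalarTower k L F] {w : Valuation F ℤᵐ⁰} {u : Valuation L ℤᵐ⁰}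
    (hw : IsPlace (k := k) w) (hu : Function.Surjective u) (h : LiesOver w (algebraMap L F) u) :
    IsPlace (k := k) u := by
  obtain ⟨a, ha, haw⟩ := h
  refine ⟨hu, fun c hc ↦ ?_⟩
  have := haw (algebraMap k L c)
  rw [← IsScalarTower.algebraMap_apply k L F, hw.2 c hc] at this
  exact (pow_left_inj₀ zero_le zero_le ha.ne').1 (this.symm.trans (one_pow a).symm)

variable {k K L M : Type*} [Field k] [Field K] [Field L] [Field M]
  [Algebra k K] [Algebra k L] [Algebra k M] [Algebra K L] [Algebra K M]
  {ι : Type*} {F : ι → Type*} [∀ i, Field (F i)] [∀ i, Algebra K (F i)]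

lemma finiteDimensional_factor [FiniteDimensional K L] [FiniteDimensional K M]
    (e : (L ⊗[K] M) ≃ₐ[K] ((i : ι) → F i)) (i : ι) :
    FiniteDimensional K (F i) :=
  Module.Finite.of_surjective ((LinearMap.proj i).comp e.toLinearMap)
    ((Function.surjective_eval i).comp e.surjective)

variable [∀ i, Algebra M (F i)] [∀ i, IsScalarTower K M (F i)]

lemma sum_finrank_factor [Fintype ι] [FiniteDimensional K L] [FiniteDimensional K M]
    (e : (L ⊗[K] M) ≃ₐ[K] ((i : ι) → F i)) :
    ∑ i, Module.finrank M (F i) = Module.finrank K L := by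
  have := finiteDimensional_factor e
  have h := e.toLinearEquiv.finrank_eq
  rw [Module.finrank_tensorProduct, Module.finrank_pi_fintype] at h
  simp_rw [← Module.finrank_mul_finrank K M (F _)] at h
  rw [← Finset.mul_sum, mul_comm] at h
  exact (Nat.eq_of_mul_eq_mul_left Module.finrank_pos h).symm

variable [∀ i, Algebra L (F i)]

lemma isSeparable_factor [∀ i, IsScalarTower K L (F i)] [Algebra.IsSeparable K L]
    (e : (L ⊗[K] M) ≃ₐ[K] ((i : ι) → F i))
    (he : ∀ (i : ι) (l : L) (m : M),
      e (l ⊗ₜ[K] m) i = algebraMap L (F i) l * algebraMap M (F i) m) (i : ι) :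
    Algebra.IsSeparable M (F i) := by
  rw [← separableClosure.eq_top_iff, eq_top_iff]
  rintro y -
  obtain ⟨w, rfl⟩ := ((Function.surjective_eval i).comp e.surjective) y
  induction w using TensorProduct.induction_on with
  | zero => simp
  | add w w' h h' => simpa using add_mem h h'
  | tmul l m =>
    change e (l ⊗ₜ[K] m) i ∈ _
    rw [he]
    refine mul_mem ?_ (algebraMap_mem _ m)
    rw [mem_separableClosure_iff]
    exact ((Algebra.IsSeparable.isSeparable K l).map
      (f := IsScalarTower.toAlgHom K L (F i)) (RingHom.injective _)).tower_top M

variable [Fintype ι] [FiniteDimensional K L] [FiniteDimensional K M] [IsScalarTower k K L]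
  [IsScalarTower k K M] [∀ i, Algebra k (F i)] [∀ i, IsScalarTower k K (F i)]
  [∀ i, IsScalarTower K L (F i)]

/-- The ramification indices over `R` of the places over `P` and `R` sum up to `e(P/S)`. -/
lemma sum_relative_ramification [IsAlgClosed k] [Algebra.IsSeparable K L]
    (hK : IsFunctionFieldOver k K) (hL : IsFunctionFieldOver k L)
    (e : (L ⊗[K] M) ≃ₐ[K] ((i : ι) → F i))
    (he : ∀ (i : ι) (l : L) (m : M),
      e (l ⊗ₜ[K] m) i = algebraMap L (F i) l * algebraMap M (F i) m)
    {S : Valuation K ℤᵐ⁰} {P : Valuation L ℤᵐ⁰} {R : Valuation M ℤᵐ⁰}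
    (hS : IsPlace (k := k) S) (hP : IsPlace (k := k) P) (hR : IsPlace (k := k) R) {eP : ℕ}
    (hPS : LiesOverE P (algebraMap K L) S eP) (hRS : LiesOver R (algebraMap K M) S)
    {Pl : (i : ι) → Finset (Valuation (F i) ℤᵐ⁰)}
    (hPl : ∀ (i : ι) (Q : Valuation (F i) ℤᵐ⁰), Q ∈ Pl i ↔ (IsPlace (k := k) Q ∧
        LiesOver Q (algebraMap L (F i)) P ∧ LiesOver Q (algebraMap M (F i)) R))
    {ε : (i : ι) → Valuation (F i) ℤᵐ⁰ → ℕ}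
    (hε : ∀ i, ∀ Q ∈ Pl i, LiesOverE Q (algebraMap M (F i)) R (ε i Q)) :
    ∑ i, ∑ Q ∈ Pl i, ε i Q = eP := by
  classical
  have hfin := finiteDimensional_factor e
  have hfinM : ∀ i, FiniteDimensional M (F i) := fun i ↦ .of_restrictScalars_finite K M (F i)
  have hsep := isSeparable_factor e he
  have : ∀ i, IsScalarTower k M (F i) := fun i ↦ .of_algebraMap_eq fun x ↦ by
    rw [IsScalarTower.algebraMap_apply k K (F i), IsScalarTower.algebraMap_apply K M (F i),
      ← IsScalarTower.algebraMap_apply k K M]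
  have : ∀ i, IsScalarTower k L (F i) := fun i ↦ .of_algebraMap_eq fun x ↦ by
    rw [IsScalarTower.algebraMap_apply k K (F i), IsScalarTower.algebraMap_apply K L (F i),
      ← IsScalarTower.algebraMap_apply k K L]
  choose T ε' hT hsum using fun i ↦ exists_places_sum_eq_finrank (F := F i)
    (trdeg_le_one_of_isAlgebraic hK.trdeg_le_one) hR
  have hu : ∀ i (Q : Valuation (F i) ℤᵐ⁰), ∃ u : Valuation L ℤᵐ⁰, Q ∈ T i →
      IsPlace (k := k) u ∧ LiesOver Q (algebraMap L (F i)) u ∧ LiesOver u (algebraMap K L) S := by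
    intro i Q
    by_cases hQ : Q ∈ T i
    swap
    · exact ⟨P, fun h ↦ absurd h hQ⟩
    obtain ⟨eR, heR⟩ := hRS
    have hQS : LiesOver Q ((algebraMap L (F i)).comp (algebraMap K L)) S := by
      refine ⟨ε' i Q * eR, ?_⟩
      rw [← IsScalarTower.algebraMap_eq, IsScalarTower.algebraMap_eq K M (F i)]
      exact (hT i Q hQ).2.comp heR
    obtain ⟨u, hu, hQu, huS⟩ := exists_liesOver_intermediate hS.1 hQS
    exact ⟨u, fun _ ↦ ⟨isPlace_of_liesOver (hT i Q hQ).1 hu hQu, hQu, huS⟩⟩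
  choose u hu using hu
  let Ps : Finset (Valuation L ℤᵐ⁰) := insert P (Finset.univ.biUnion fun i ↦ (T i).image (u i))
  have hPs : ∀ P' ∈ Ps, ∃ e', IsPlace (k := k) P' ∧ LiesOverE P' (algebraMap K L) S e' := by
    intro P' hP'
    rcases Finset.mem_insert.1 hP' with rfl | h
    · exact ⟨eP, hP, hPS⟩
    · obtain ⟨i, -, hi⟩ := Finset.mem_biUnion.1 h
      obtain ⟨Q, hQ, rfl⟩ := Finset.mem_image.1 hi
      obtain ⟨h1, -, e', h2⟩ := hu i Q hQ
      exact ⟨e', h1, h2⟩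
  choose! eS hPs' heS using hPs
  have hmem : ∀ i, ∀ Q ∈ T i, u i Q ∈ Ps := fun i Q hQ ↦ Finset.mem_insert_of_mem
    (Finset.mem_biUnion.2 ⟨i, Finset.mem_univ i, Finset.mem_image_of_mem _ hQ⟩)
  have htotal : ∑ P' ∈ Ps, ∑ i, ∑ Q ∈ T i with u i Q = P', ε' i Q = Module.finrank K L := by
    rw [Finset.sum_comm, ← sum_finrank_factor e]
    refine Finset.sum_congr rfl fun i _ ↦ ?_
    rw [Finset.sum_fiberwise_of_maps_to (hmem i), hsum]
  have hle : ∀ P' ∈ Ps, ∑ i, ∑ Q ∈ T i with u i Q = P', ε' i Q ≤ eS P' := fun P' hP' ↦ by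
    refine sum_ramification_le_ramification hL.trdeg_le_one e he hS.1 (hPs' P' hP') (heS P' hP')
      (R := R) fun i Q hQ ↦ ?_
    obtain ⟨hQT, rfl⟩ := Finset.mem_filter.1 hQ
    exact ⟨(hT i Q hQT).1.1, (hu i Q hQT).2.1, (hT i Q hQT).2⟩
  have hle' : ∑ P' ∈ Ps, eS P' ≤ Module.finrank K L :=
    sum_ramification_le_finrank fun P' hP' ↦ ⟨(hPs' P' hP').1, heS P' hP'⟩
  have hPPs : P ∈ Ps := Finset.mem_insert_self _ _
  have heq := (Finset.sum_eq_sum_iff_of_le hle).1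
    (le_antisymm (Finset.sum_le_sum hle) (hle'.trans htotal.ge)) P hPPs
  rw [(heS P hPPs).unique hS.1 hPS] at heq
  refine le_antisymm (sum_ramification_le_ramification hL.trdeg_le_one e he hS.1 hP hPS (R := R)
    fun i Q hQ ↦ ⟨((hPl i Q).1 hQ).1.1, ((hPl i Q).1 hQ).2.1, hε i Q hQ⟩) ?_
  rw [← heq]
  refine Finset.sum_le_sum fun i _ ↦ ?_
  have hsub : (T i).filter (fun Q ↦ u i Q = P) ⊆ Pl i := fun Q hQ ↦ by
    obtain ⟨hQT, hQP⟩ := Finset.mem_filter.1 hQ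
    exact (hPl i Q).2 ⟨(hT i Q hQT).1, hQP ▸ (hu i Q hQT).2.1, _, (hT i Q hQT).2⟩
  refine (Finset.sum_congr rfl fun Q hQ ↦ ?_).trans_le (Finset.sum_le_sum_of_subset hsub)
  exact (hT i Q (Finset.mem_filter.1 hQ).1).2.unique hR.1 (hε i Q (hsub hQ))

/-- `sum_ramification_indices` when `L/K` is separable. -/
lemma sum_ramification_of_isSeparable [IsAlgClosed k] [Algebra.IsSeparable K L]
    (hK : IsFunctionFieldOver k K) (hL : IsFunctionFieldOver k L)
    (e : (L ⊗[K] M) ≃ₐ[K] ((i : ι) → F i))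
    (he : ∀ (i : ι) (l : L) (m : M),
      e (l ⊗ₜ[K] m) i = algebraMap L (F i) l * algebraMap M (F i) m)
    {S : Valuation K ℤᵐ⁰} {P : Valuation L ℤᵐ⁰} {R : Valuation M ℤᵐ⁰}
    (hS : IsPlace (k := k) S) (hP : IsPlace (k := k) P) (hR : IsPlace (k := k) R) {eP eR : ℕ}
    (hPS : LiesOverE P (algebraMap K L) S eP) (hRS : LiesOverE R (algebraMap K M) S eR)
    {Pl : (i : ι) → Finset (Valuation (F i) ℤᵐ⁰)}
    (hPl : ∀ (i : ι) (Q : Valuation (F i) ℤᵐ⁰), Q ∈ Pl i ↔ (IsPlace (k := k) Q ∧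
        LiesOver Q (algebraMap L (F i)) P ∧ LiesOver Q (algebraMap M (F i)) R))
    {eQ : (i : ι) → Valuation (F i) ℤᵐ⁰ → ℕ}
    (heQ : ∀ i, ∀ Q ∈ Pl i, LiesOverE Q (algebraMap K (F i)) S (eQ i Q)) :
    ∑ i, ∑ Q ∈ Pl i, eQ i Q = eP * eR := by
  choose! ε hε using fun i Q (hQ : Q ∈ Pl i) ↦ ((hPl i Q).1 hQ).2.2
  rw [← sum_relative_ramification hK hL e he hS hP hR hPS ⟨eR, hRS⟩ hPl hε, Finset.sum_mul]
  refine Finset.sum_congr rfl fun i _ ↦ ?_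
  rw [Finset.sum_mul]
  refine Finset.sum_congr rfl fun Q hQ ↦ (heQ i Q hQ).unique hS.1 ?_
  rw [IsScalarTower.algebraMap_eq K M (F i)]
  exact (hε i Q hQ).comp hRS

end Main

/-- **Corollary (sum of ramification indices over two places).**
Let `L/K` and `M/K` be finite extensions of function fields of curves over an algebraically
closed field `k`, at least one of them separable, and let `L ⊗[K] M ≃ F₁ × ⋯ × Fₙ` be the
decomposition into fields.  Let `S`, `P`, `R` be places of `K`, `L`, `M` with `P`, `R`
lying over `S`, and for each `i` let `𝒫ᵢ` be the (finite) set of places of `Fᵢ` lying over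
both `P` and `R`.  Then `∑ᵢ ∑_{Q ∈ 𝒫ᵢ} e(Q/S) = e(P/S) ⬝ e(R/S)`. -/
theorem sum_ramification_indices
    {k K L M : Type*} [Field k] [IsAlgClosed k] [Field K] [Field L] [Field M]
    [Algebra k K] [Algebra k L] [Algebra k M]
    [Algebra K L] [Algebra K M] [IsScalarTower k K L] [IsScalarTower k K M]
    (hK : IsFunctionFieldOver k K) (hL : IsFunctionFieldOver k L)
    (hM : IsFunctionFieldOver k M)
    [FiniteDimensional K L] [FiniteDimensional K M]
    -- the decomposition of `L ⊗[K] M` as a finite product of fields `Fᵢ`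
    {n : ℕ} (F : Fin n → Type*) [∀ i, Field (F i)]
    [∀ i, Algebra k (F i)] [∀ i, Algebra K (F i)] [∀ i, Algebra L (F i)]
    [∀ i, Algebra M (F i)] [∀ i, IsScalarTower k K (F i)]
    [∀ i, IsScalarTower K L (F i)] [∀ i, IsScalarTower K M (F i)]
    (e : (L ⊗[K] M) ≃ₐ[K] ((i : Fin n) → F i))
    (he : ∀ (i : Fin n) (l : L) (m : M),
      e (l ⊗ₜ[K] m) i = algebraMap L (F i) l * algebraMap M (F i) m)
    -- the places `S`, `P`, `R`, with `P` and `R` lying over `S`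
    (S : Valuation K (WithZero (Multiplicative ℤ)))
    (P : Valuation L (WithZero (Multiplicative ℤ)))
    (R : Valuation M (WithZero (Multiplicative ℤ)))
    (hS : IsPlace (k := k) S) (hP : IsPlace (k := k) P) (hR : IsPlace (k := k) R)
    (hPS : LiesOver P (algebraMap K L) S) (hRS : LiesOver R (algebraMap K M) S)
    (hsep : Algebra.IsSeparable K L ∨ Algebra.IsSeparable K M)
    -- `Pl i` is the set `𝒫ᵢ` of places of `Fᵢ` lying over both `P` and `R`
    (Pl : (i : Fin n) → Finset (Valuation (F i) (WithZero (Multiplicative ℤ))))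
    (hPl : ∀ (i : Fin n) (Q : Valuation (F i) (WithZero (Multiplicative ℤ))),
      Q ∈ Pl i ↔ (IsPlace (k := k) Q ∧
        LiesOver Q (algebraMap L (F i)) P ∧ LiesOver Q (algebraMap M (F i)) R)) :
    ∀ eP eR : ℕ, LiesOverE P (algebraMap K L) S eP → LiesOverE R (algebraMap K M) S eR →
    ∀ eQ : (i : Fin n) → Valuation (F i) (WithZero (Multiplicative ℤ)) → ℕ,
      (∀ i, ∀ Q ∈ Pl i, LiesOverE Q (algebraMap K (F i)) S (eQ i Q)) →
      ∑ i : Fin n, ∑ Q ∈ Pl i, eQ i Q = eP * eR := by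
  intro eP eR hPS' hRS' eQ heQ
  rcases hsep with hsep | hsep
  · exact sum_ramification_of_isSeparable hK hL e he hS hP hR hPS' hRS' hPl heQ
  · rw [mul_comm]
    refine sum_ramification_of_isSeparable hK hM ((Algebra.TensorProduct.comm K M L).trans e)
      (fun i m l ↦ ?_) hS hR hP hRS' hPS' (fun i Q ↦ ?_) heQ
    · simp [he, mul_comm]
    · rw [hPl, and_comm (a := LiesOver Q (algebraMap L (F i)) P)]
end
end
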